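/- arXiv:1711.07524 — 3 statements merged into one kernel-verified Lean document; each statement's English description precedes it below -/
import Mathlib

section
/- Let n ≥ 2. The maximum number of Hamiltonian paths of the complete graph K_n such that the union of every two distinct paths in the family contains a triangle (a cycle of length 3) equals binom(n, (n−1)/2) when n is odd, and equals (1/2)·binom(n, n/2) when n is even. -/
open SimpleGraph

/-- `G` is (the edge graph of) a Hamiltonian path of the complete graph on `Fin n`:
it is the image of the path graph under a relabelling of the vertices. -/
def IsHamPathGraph {n : ℕ} (G : SimpleGraph (Fin n)) : Prop :=
  ∃ σ : Fin n ≃ Fin n, G = (pathGraph n).map σ.toEmbedding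


section TrianglePaths
variable {α : Type*}

def inter : List α → List α → List α
  | [], V => V
  | w :: W, V => w :: inter V W
termination_by W V => W.length + V.length

def Nb (x y : α) (l : List α) : Prop := [x, y] <:+: l ∨ [y, x] <:+: l
def D2 (x y : α) (l : List α) : Prop := ∃ z, [x, z, y] <:+: l ∨ [y, z, x] <:+: l
def TriSep (P Q : List α) : Prop := ∃ x y, (Nb x y P ∧ D2 x y Q) ∨ (Nb x y Q ∧ D2 x y P)

theorem TriSep.symm {P Q : List α} (h : TriSep P Q) : TriSep Q P := by
  obtain ⟨x, y, h⟩ := h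
  exact ⟨x, y, h.symm⟩

theorem Nb.symm {x y : α} {l : List α} (h : Nb x y l) : Nb y x l := Or.symm h

theorem Nb.mono {x y : α} {l l' : List α} (h : Nb x y l) (hl : l <:+: l') : Nb x y l' :=
  h.imp (·.trans hl) (·.trans hl)

theorem D2.mono {x y : α} {l l' : List α} (h : D2 x y l) (hl : l <:+: l') : D2 x y l' := by
  obtain ⟨z, h⟩ := h
  exact ⟨z, h.imp (·.trans hl) (·.trans hl)⟩

theorem Nb.reverse {x y : α} {l : List α} (h : Nb x y l) : Nb x y l.reverse := by
  rcases h with h | h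
  · right; simpa using List.reverse_infix.2 h
  · left; simpa using List.reverse_infix.2 h

theorem inter_perm (W V : List α) : (inter W V).Perm (W ++ V) := by
  induction W, V using inter.induct with
  | case1 V => simp [inter]
  | case2 w W V ih =>
    rw [inter]
    exact (ih.trans List.perm_append_comm).cons w

theorem inter_between (n : ℕ) : ∀ (W V : List α) (x y : α), W.length + V.length ≤ n →
    (([x, y] <:+: W → W.length ≤ V.length + 1 → ∃ z, [x, z, y] <:+: inter W V) ∧
     ([x, y] <:+: V → V.length ≤ W.length → ∃ z, [x, z, y] <:+: inter W V)) := by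
  induction n with
  | zero =>
    intro W V x y h
    have h1 : W = [] := List.length_eq_zero_iff.1 (by omega)
    have h2 : V = [] := List.length_eq_zero_iff.1 (by omega)
    subst h1 h2
    simp
  | succ n ih =>
    intro W V x y h
    cases W with
    | nil =>
      refine ⟨by simp, ?_⟩
      intro h1 h2
      have : V = [] := List.length_eq_zero_iff.1 (by simpa using h2)
      subst this
      simp at h1
    | cons w W =>
      rw [inter]
      simp only [List.length_cons] at h ⊢
      have := ih V W x y (by omega)
      constructor
      · intro h1 h2
        rw [List.infix_cons_iff] at h1
        rcases h1 with h1 | h1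
        · rw [List.cons_prefix_cons] at h1
          obtain ⟨rfl, t, rfl⟩ := h1
          cases V with
          | nil => simp at h2
          | cons v V =>
            refine ⟨v, [], inter V t, ?_⟩
            simp [inter]
        · obtain ⟨z, hz⟩ := this.2 h1 (by omega)
          exact ⟨z, hz.trans (List.suffix_cons _ _).isInfix⟩
      · intro h1 h2
        obtain ⟨z, hz⟩ := this.1 h1 (by omega)
        exact ⟨z, hz.trans (List.suffix_cons _ _).isInfix⟩

theorem d2_inter_left {W V : List α} {x y : α} (h : Nb x y W) (hl : W.length ≤ V.length + 1) :
    D2 x y (inter W V) := by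
  rcases h with h | h
  · obtain ⟨z, hz⟩ := (inter_between _ W V x y le_rfl).1 h hl
    exact ⟨z, Or.inl hz⟩
  · obtain ⟨z, hz⟩ := (inter_between _ W V y x le_rfl).1 h hl
    exact ⟨z, Or.inr hz⟩

theorem d2_inter_right {W V : List α} {x y : α} (h : Nb x y V) (hl : V.length ≤ W.length) :
    D2 x y (inter W V) := by
  rcases h with h | h
  · obtain ⟨z, hz⟩ := (inter_between _ W V x y le_rfl).2 h hl
    exact ⟨z, Or.inl hz⟩
  · obtain ⟨z, hz⟩ := (inter_between _ W V y x le_rfl).2 h hl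
    exact ⟨z, Or.inr hz⟩

theorem inter_concat : ∀ (X Y : List α) (x y : α), X.length = Y.length →
    inter (X ++ [x]) (Y ++ [y]) = inter X Y ++ [x, y] := by
  intro X
  induction X with
  | nil =>
    intro Y x y h
    have : Y = [] := List.length_eq_zero_iff.1 (by simpa using h.symm)
    subst this
    simp [inter]
  | cons a X ih =>
    intro Y x y h
    cases Y with
    | nil => simp at h
    | cons b Y =>
      simp only [List.cons_append, inter]
      rw [ih Y x y (by simpa using h)]

/-- colour of a list -/
def col (c : α → Bool) (X : List α) : Bool := (X.map c).headD false

def stp (c : α → Bool) :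
    List (List α) → List (List α) × List (List α × List α) × List (List α)
  | [] => ([], [], [])
  | [R] => ([R], [], [])
  | X :: Y :: L =>
    if col c X = col c Y then
      ((stp c L).1, (stp c L).2.1, (X ++ Y.reverse) :: (stp c L).2.2)
    else ((stp c L).1, (X, Y) :: (stp c L).2.1, (stp c L).2.2)

def dec (c : α → Bool) : ℕ → List (List α) → List (List α) × List (List α × List α)
  | 0, _ => ([], [])
  | m + 1, L =>
    ((stp c L).1 ++ (dec c m (stp c L).2.2).1, (stp c L).2.1 ++ (dec c m (stp c L).2.2).2)

def Good (c : α → Bool) (k : ℕ) (L : List (List α)) : Prop :=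
  ∀ X ∈ L, X.length = k ∧ ∀ x ∈ X, c x = col c X

def bal (c : α → Bool) (L : List (List α)) : ℤ :=
  (L.map (fun X => if col c X then (1 : ℤ) else -1)).sum

theorem col_append (c : α → Bool) (X Y : List α) (h : X ≠ []) : col c (X ++ Y) = col c X := by
  cases X with
  | nil => exact absurd rfl h
  | cons a X => simp [col]

theorem stp_left (c c' : α → Bool) (L : List (List α)) : (stp c L).1 = (stp c' L).1 := by
  induction L using stp.induct c with
  | case1 => simp [stp]
  | case2 => simp [stp]
  | case3 X Y L h ih => rw [stp, stp]; split_ifs <;> exact ih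
  | case4 X Y L h ih => rw [stp, stp]; split_ifs <;> exact ih

theorem stp_left_cases (c : α → Bool) (L : List (List α)) :
    (stp c L).1 = [] ∨ ∃ R, R ∈ L ∧ (stp c L).1 = [R] := by
  induction L using stp.induct c with
  | case1 => simp [stp]
  | case2 => simp [stp]
  | case3 X Y L h ih =>
    rw [stp, if_pos h]
    exact ih.imp id (fun ⟨R, h1, h2⟩ => ⟨R, by simp [h1], h2⟩)
  | case4 X Y L h ih =>
    rw [stp, if_neg h]
    exact ih.imp id (fun ⟨R, h1, h2⟩ => ⟨R, by simp [h1], h2⟩)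

theorem stp_mixed (c : α → Bool) (L : List (List α)) :
    ∀ p ∈ (stp c L).2.1, p.1 ∈ L ∧ p.2 ∈ L ∧ col c p.1 ≠ col c p.2 := by
  induction L using stp.induct c with
  | case1 => simp [stp]
  | case2 => simp [stp]
  | case3 X Y L h ih =>
    rw [stp, if_pos h]
    intro p hp
    obtain ⟨h1, h2, h3⟩ := ih p hp
    exact ⟨by simp [h1], by simp [h2], h3⟩
  | case4 X Y L h ih =>
    rw [stp, if_neg h]
    intro p hp
    rcases List.mem_cons.1 hp with rfl | hp
    · exact ⟨by simp, by simp, h⟩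
    obtain ⟨h1, h2, h3⟩ := ih p hp
    exact ⟨by simp [h1], by simp [h2], h3⟩

theorem stp_merged (c : α → Bool) (L : List (List α)) :
    ∀ Z ∈ (stp c L).2.2, ∃ X ∈ L, ∃ Y ∈ L, col c X = col c Y ∧ Z = X ++ Y.reverse := by
  induction L using stp.induct c with
  | case1 => simp [stp]
  | case2 => simp [stp]
  | case3 X Y L h ih =>
    rw [stp, if_pos h]
    intro Z hp
    rcases List.mem_cons.1 hp with rfl | hp
    · exact ⟨X, by simp, Y, by simp, h, rfl⟩
    obtain ⟨X', h1, Y', h2, h3⟩ := ih Z hp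
    exact ⟨X', by simp [h1], Y', by simp [h2], h3⟩
  | case4 X Y L h ih =>
    rw [stp, if_neg h]
    intro Z hp
    obtain ⟨X', h1, Y', h2, h3⟩ := ih Z hp
    exact ⟨X', by simp [h1], Y', by simp [h2], h3⟩

theorem stp_good {c : α → Bool} {k : ℕ} {L : List (List α)} (hk : 0 < k) (h : Good c k L) :
    Good c (2 * k) (stp c L).2.2 := by
  intro Z hZ
  obtain ⟨X, hX, Y, hY, h1, rfl⟩ := stp_merged c L Z hZ
  have hX' := h X hX
  have hY' := h Y hY
  have : X ≠ [] := by rintro rfl; simp at hX'; omega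
  rw [col_append c _ _ this]
  refine ⟨by simp; omega, ?_⟩
  intro x hx
  rcases List.mem_append.1 hx with hx | hx
  · exact hX'.2 x hx
  · rw [h1]; exact hY'.2 x (List.mem_reverse.1 hx)

theorem stp_length (c : α → Bool) (L : List (List α)) : 2 * (stp c L).2.2.length ≤ L.length := by
  induction L using stp.induct c with
  | case1 => simp [stp]
  | case2 => simp [stp]
  | case3 X Y L h ih => rw [stp, if_pos h]; simp; omega
  | case4 X Y L h ih => rw [stp, if_neg h]; simp; omega

theorem stp_nb {c : α → Bool} {x y : α} (L : List (List α)) :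
    ∀ Z ∈ L, Nb x y Z → (∃ W ∈ (stp c L).1, Nb x y W) ∨
      (∃ p ∈ (stp c L).2.1, Nb x y p.1 ∨ Nb x y p.2) ∨ ∃ W ∈ (stp c L).2.2, Nb x y W := by
  induction L using stp.induct c with
  | case1 => simp
  | case2 => simp [stp]
  | case3 X Y L h ih =>
    rw [stp, if_pos h]
    intro Z hZ hn
    rcases List.mem_cons.1 hZ with rfl | hZ
    · right; right
      exact ⟨_, List.mem_cons_self, hn.mono (List.prefix_append _ _).isInfix⟩
    rcases List.mem_cons.1 hZ with rfl | hZ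
    · right; right
      exact ⟨_, List.mem_cons_self, hn.reverse.mono (List.suffix_append _ _).isInfix⟩
    rcases ih Z hZ hn with h | h | ⟨W, h, h'⟩
    · exact Or.inl h
    · exact Or.inr (Or.inl h)
    · exact Or.inr (Or.inr ⟨W, List.mem_cons_of_mem _ h, h'⟩)
  | case4 X Y L h ih =>
    rw [stp, if_neg h]
    intro Z hZ hn
    rcases List.mem_cons.1 hZ with rfl | hZ
    · right; left
      exact ⟨_, List.mem_cons_self, Or.inl hn⟩
    rcases List.mem_cons.1 hZ with rfl | hZ
    · right; left
      exact ⟨_, List.mem_cons_self, Or.inr hn⟩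
    rcases ih Z hZ hn with h | ⟨W, h, h'⟩ | h
    · exact Or.inl h
    · exact Or.inr (Or.inl ⟨W, List.mem_cons_of_mem _ h, h'⟩)
    · exact Or.inr (Or.inr h)

theorem stp_perm (c : α → Bool) (L : List (List α)) : L.flatten.Perm
    ((stp c L).1.flatten ++ ((stp c L).2.1.flatMap (fun p => p.1 ++ p.2) ++ (stp c L).2.2.flatten)) := by
  classical
  induction L using stp.induct c with
  | case1 => simp [stp]
  | case2 => simp [stp]
  | case3 X Y L h ih =>
    rw [stp, if_pos h]
    rw [List.perm_iff_count] at ih ⊢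
    intro a
    have := ih a
    simp only [List.count_append, List.flatten_cons, List.count_reverse] at this ⊢
    omega
  | case4 X Y L h ih =>
    rw [stp, if_neg h]
    rw [List.perm_iff_count] at ih ⊢
    intro a
    have := ih a
    simp only [List.count_append, List.flatten_cons, List.flatMap_cons] at this ⊢
    omega

theorem stp_bal {c : α → Bool} (L : List (List α)) (hL : ∀ X ∈ L, X ≠ []) :
    bal c L = bal c (stp c L).1 + 2 * bal c (stp c L).2.2 := by
  induction L using stp.induct c with
  | case1 => simp [stp, bal]
  | case2 => simp [stp, bal]
  | case3 X Y L h ih =>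
    rw [stp, if_pos h]
    have := ih (fun X hX => hL X (by simp [hX]))
    simp only [bal, List.map_cons, List.sum_cons] at this ⊢
    rw [col_append c X _ (hL X (by simp)), this, ← h]
    ring
  | case4 X Y L h ih =>
    rw [stp, if_neg h]
    have := ih (fun X hX => hL X (by simp [hX]))
    simp only [bal, List.map_cons, List.sum_cons] at this ⊢
    rw [this]
    cases hX : col c X <;> cases hY : col c Y <;> simp_all

theorem stp_diff {c c' : α → Bool} (L : List (List α)) (h : stp c L ≠ stp c' L) :
    ∃ X ∈ L, ∃ Y ∈ L, ((X, Y) ∈ (stp c L).2.1 ∧ X ++ Y.reverse ∈ (stp c' L).2.2) ∨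
      ((X, Y) ∈ (stp c' L).2.1 ∧ X ++ Y.reverse ∈ (stp c L).2.2) := by
  induction L using stp.induct c with
  | case1 => simp [stp] at h
  | case2 => simp [stp] at h
  | case3 X Y L h1 ih =>
    by_cases h2 : col c' X = col c' Y
    · simp only [stp, if_pos h1, if_pos h2] at h ⊢
      have : stp c L ≠ stp c' L := fun e => h (by rw [e])
      obtain ⟨X', hX, Y', hY, h'⟩ := ih this
      exact ⟨X', by simp [hX], Y', by simp [hY], by simp; tauto⟩
    · simp only [stp, if_pos h1, if_neg h2]
      exact ⟨X, by simp, Y, by simp, by simp⟩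
  | case4 X Y L h1 ih =>
    by_cases h2 : col c' X = col c' Y
    · simp only [stp, if_neg h1, if_pos h2]
      exact ⟨X, by simp, Y, by simp, by simp⟩
    · simp only [stp, if_neg h1, if_neg h2] at h ⊢
      have : stp c L ≠ stp c' L := fun e => h (by rw [e])
      obtain ⟨X', hX, Y', hY, h'⟩ := ih this
      exact ⟨X', by simp [hX], Y', by simp [hY], by simp; tauto⟩


def Comp (d : List (List α) × List (List α × List α)) (x y : α) : Prop :=
  (∃ W ∈ d.1, Nb x y W) ∨ ∃ p ∈ d.2, Nb x y p.1 ∨ Nb x y p.2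

theorem dec_perm (c : α → Bool) (m : ℕ) : ∀ (L : List (List α)), L.length ≤ m → L.flatten.Perm
    ((dec c m L).1.flatten ++ (dec c m L).2.flatMap (fun p => p.1 ++ p.2)) := by
  classical
  induction m with
  | zero =>
    intro L h
    have : L = [] := List.length_eq_zero_iff.1 (by omega)
    subst this
    simp [dec]
  | succ m ih =>
    intro L h
    have h1 := stp_perm c L
    have h2 := ih (stp c L).2.2 (by have := stp_length c L; omega)
    rw [dec]
    rw [List.perm_iff_count] at h1 h2 ⊢
    intro a
    have h1 := h1 a
    have h2 := h2 a
    simp only [List.count_append, List.flatten_append, List.flatMap_append] at h1 h2 ⊢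
    omega

theorem dec_nb {c : α → Bool} {x y : α} (m : ℕ) : ∀ (L : List (List α)), L.length ≤ m →
    ∀ Z ∈ L, Nb x y Z → Comp (dec c m L) x y := by
  induction m with
  | zero =>
    intro L h
    have : L = [] := List.length_eq_zero_iff.1 (by omega)
    subst this
    simp
  | succ m ih =>
    intro L h Z hZ hn
    rw [dec]
    rcases stp_nb (c := c) L Z hZ hn with ⟨W, h, h'⟩ | ⟨W, h, h'⟩ | ⟨W, hW, h'⟩
    · exact Or.inl ⟨W, List.mem_append_left _ h, h'⟩
    · exact Or.inr ⟨W, List.mem_append_left _ h, h'⟩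
    · rcases ih (stp c L).2.2 (by have := stp_length c L; omega) W hW h' with
        ⟨W, h, h'⟩ | ⟨W, h, h'⟩
      · exact Or.inl ⟨W, List.mem_append_right _ h, h'⟩
      · exact Or.inr ⟨W, List.mem_append_right _ h, h'⟩

theorem dec_good {c : α → Bool} (m : ℕ) : ∀ (k : ℕ) (L : List (List α)), 0 < k → Good c k L →
    (∀ R ∈ (dec c m L).1, ∀ x ∈ R, c x = col c R) ∧
    (∀ p ∈ (dec c m L).2, p.1 ≠ [] ∧ p.1.length = p.2.length ∧ (∀ x ∈ p.1, c x = col c p.1) ∧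
      (∀ x ∈ p.2, c x = col c p.2) ∧ col c p.1 ≠ col c p.2) := by
  induction m with
  | zero => intro k L hk h; simp [dec]
  | succ m ih =>
    intro k L hk h
    obtain ⟨h1, h2⟩ := ih (2 * k) (stp c L).2.2 (by omega) (stp_good hk h)
    rw [dec]
    constructor
    · intro R hR
      rcases List.mem_append.1 hR with hR | hR
      · rcases stp_left_cases c L with h' | ⟨R', h', h''⟩
        · simp [h'] at hR
        · rw [h'', List.mem_singleton] at hR
          subst hR
          exact (h _ h').2
      · exact h1 R hR
    · intro p hp
      rcases List.mem_append.1 hp with hp | hp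
      · obtain ⟨h3, h4, h5⟩ := stp_mixed c L p hp
        have h6 := h _ h3
        have h7 := h _ h4
        refine ⟨?_, by omega, h6.2, h7.2, h5⟩
        intro e
        rw [e] at h6
        simp at h6
        omega
      · exact h2 p hp

theorem Good.ne_nil {c : α → Bool} {k : ℕ} {L : List (List α)} (hk : 0 < k) (h : Good c k L) :
    ∀ X ∈ L, X ≠ [] := by
  intro X hX e
  have := (h X hX).1
  rw [e] at this
  simp at this
  omega

theorem dec_lead {c : α → Bool} (m : ℕ) : ∀ (k : ℕ) (L : List (List α)), 0 < k → Good c k L →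
    L.length ≤ m →
    (bal c L = 0 → (dec c m L).1 = []) ∧
    (bal c L = 1 → ∃ S R, (dec c m L).1 = S ++ [R] ∧ (∀ X ∈ S, col c X = false) ∧
      col c R = true ∧ S.flatten.length + k = R.length) := by
  induction m with
  | zero =>
    intro k L hk hg h
    have : L = [] := List.length_eq_zero_iff.1 (by omega)
    subst this
    simp [dec, bal]
  | succ m ih =>
    intro k L hk hg h
    obtain ⟨h1, h2⟩ := ih (2 * k) (stp c L).2.2 (by omega) (stp_good hk hg)
      (by have := stp_length c L; omega)
    have hb := stp_bal (c := c) L (hg.ne_nil hk)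
    rw [dec]
    rcases stp_left_cases c L with h' | ⟨R, h', h''⟩
    · rw [h'] at hb ⊢
      have : bal c ([] : List (List α)) = 0 := by simp [bal]
      rw [this] at hb
      constructor
      · intro h0
        simpa using h1 (by omega)
      · intro h0
        omega
    · rw [h''] at hb ⊢
      have hR := (hg R h').1
      cases hc : col c R with
      | true =>
        have : bal c [R] = 1 := by simp [bal, hc]
        rw [this] at hb
        constructor
        · intro h0
          omega
        · intro h0
          refine ⟨[], R, ?_, by simp, hc, by simp [hR]⟩
          simp [h1 (by omega)]
      | false =>
        have : bal c [R] = -1 := by simp [bal, hc]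
        rw [this] at hb
        constructor
        · intro h0
          omega
        · intro h0
          obtain ⟨S, R', e1, e2, e3, e4⟩ := h2 (by omega)
          refine ⟨R :: S, R', by simp [e1], ?_, e3, ?_⟩
          · intro X hX
            rcases List.mem_cons.1 hX with rfl | hX
            · exact hc
            · exact e2 X hX
          · simp only [List.flatten_cons, List.length_append]
            omega

theorem concat_of_ne_nil {X : List α} (h : X ≠ []) : ∃ X' x, X = X' ++ [x] :=
  ⟨X.dropLast, X.getLast h, (List.dropLast_append_getLast h).symm⟩

theorem dec_diff {c c' : α → Bool} (m : ℕ) : ∀ (k : ℕ) (L : List (List α)), 0 < k → Good c k L →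
    Good c' k L → L.length ≤ m → dec c m L ≠ dec c' m L →
    ∃ X Y x y, X.length = Y.length ∧
      (((X ++ [x], Y ++ [y]) ∈ (dec c m L).2 ∧ Comp (dec c' m L) x y) ∨
       ((X ++ [x], Y ++ [y]) ∈ (dec c' m L).2 ∧ Comp (dec c m L) x y)) := by
  induction m with
  | zero =>
    intro k L hk hg hg' h hne
    simp [dec] at hne
  | succ m ih =>
    intro k L hk hg hg' h hne
    by_cases hs : stp c L = stp c' L
    · have hl : (stp c L).2.2.length ≤ m := by have := stp_length c L; omega
      have := ih (2 * k) (stp c L).2.2 (by omega) (stp_good hk hg) (hs ▸ stp_good hk hg') hl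
        (by
          intro e
          apply hne
          rw [dec, dec, ← hs, e])
      rw [dec, dec, ← hs]
      obtain ⟨X, Y, x, y, hl, h'⟩ := this
      refine ⟨X, Y, x, y, hl, ?_⟩
      have aux : ∀ d : List (List α) × List (List α × List α), Comp d x y →
          Comp ((stp c L).1 ++ d.1, (stp c L).2.1 ++ d.2) x y := by
        rintro d (⟨W, h, h'⟩ | ⟨W, h, h'⟩)
        · exact Or.inl ⟨W, List.mem_append_right _ h, h'⟩
        · exact Or.inr ⟨W, List.mem_append_right _ h, h'⟩
      exact h'.imp (fun h => ⟨List.mem_append_right _ h.1, aux _ h.2⟩)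
        (fun h => ⟨List.mem_append_right _ h.1, aux _ h.2⟩)
    · obtain ⟨X, hX, Y, hY, h'⟩ := stp_diff L hs
      obtain ⟨X', x, rfl⟩ := concat_of_ne_nil (hg.ne_nil hk X hX)
      obtain ⟨Y', y, rfl⟩ := concat_of_ne_nil (hg.ne_nil hk Y hY)
      have hl : X'.length = Y'.length := by
        have h1 := (hg _ hX).1
        have h2 := (hg _ hY).1
        simp at h1 h2
        omega
      have hn : Nb x y ((X' ++ [x]) ++ (Y' ++ [y]).reverse) := by
        left
        exact ⟨X', Y'.reverse, by simp⟩
      refine ⟨X', Y', x, y, hl, ?_⟩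
      have aux : ∀ c : α → Bool, (X' ++ [x]) ++ (Y' ++ [y]).reverse ∈ (stp c L).2.2 →
          Comp (dec c (m + 1) L) x y := by
        intro c hc
        rw [dec]
        rcases dec_nb (c := c) m (stp c L).2.2 (by have := stp_length c L; omega) _ hc hn with
          ⟨W, h, h'⟩ | ⟨W, h, h'⟩
        · exact Or.inl ⟨W, List.mem_append_right _ h, h'⟩
        · exact Or.inr ⟨W, List.mem_append_right _ h, h'⟩
      exact h'.imp (fun h => ⟨List.mem_append_left _ h.1, aux _ h.2⟩)
        (fun h => ⟨List.mem_append_left _ h.1, aux _ h.2⟩)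

def ori (c : α → Bool) (p : List α × List α) : List α :=
  if col c p.1 then inter p.2 p.1 else inter p.1 p.2

def pth (c : α → Bool) (d : List (List α) × List (List α × List α)) : List α :=
  inter (d.1.getLastD []) d.1.dropLast.flatten ++ d.2.flatMap (ori c)

theorem ori_perm (c : α → Bool) (p : List α × List α) : (ori c p).Perm (p.1 ++ p.2) := by
  unfold ori
  split_ifs
  · exact (inter_perm _ _).trans List.perm_append_comm
  · exact inter_perm _ _

theorem pth_perm (c : α → Bool) (d : List (List α) × List (List α × List α)) :
    (pth c d).Perm (d.1.flatten ++ d.2.flatMap (fun p => p.1 ++ p.2)) := by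
  unfold pth
  apply List.Perm.append
  · refine (inter_perm _ _).trans (List.perm_append_comm.trans ?_)
    rcases List.eq_nil_or_concat d.1 with h | ⟨S, R, h⟩
    · simp [h]
    · simp [h]
  · apply List.Perm.flatMap_left
    intro p _
    exact ori_perm c p

theorem ori_nb (c : α → Bool) (X Y : List α) (x y : α) (h : X.length = Y.length) :
    Nb x y (ori c (X ++ [x], Y ++ [y])) := by
  unfold ori
  split_ifs
  · rw [inter_concat _ _ _ _ h.symm]
    exact Or.inr (List.suffix_append _ _).isInfix
  · rw [inter_concat _ _ _ _ h]
    exact Or.inl (List.suffix_append _ _).isInfix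

theorem ori_contig (c : α → Bool) {p : List α × List α}
    {d : List (List α) × List (List α × List α)} (h : p ∈ d.2) : ori c p <:+: pth c d := by
  unfold pth
  obtain ⟨s, t, h⟩ := List.append_of_mem h
  rw [h]
  exact ⟨_ ++ s.flatMap (ori c), t.flatMap (ori c), by simp; rfl⟩

theorem comp_d2 (c : α → Bool) {x y : α} {d : List (List α) × List (List α × List α)}
    (h : Comp d x y) (hp : ∀ p ∈ d.2, p.1.length = p.2.length) (S : List (List α)) (R : List α)
    (hS : d.1 = S ++ [R]) (hl : S.flatten.length + 1 = R.length) : D2 x y (pth c d) := by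
  rcases h with ⟨W, hW, hn⟩ | ⟨p, hW, hn⟩
  · have : D2 x y (inter R S.flatten) := by
      rw [hS] at hW
      rcases List.mem_append.1 hW with hW | hW
      · apply d2_inter_right _ (by omega)
        apply hn.mono
        exact List.infix_of_mem_flatten hW
      · rw [List.mem_singleton] at hW
        subst hW
        exact d2_inter_left hn (by omega)
    apply this.mono
    unfold pth
    rw [hS]
    simp only [List.getLastD_concat, List.dropLast_concat]
    exact (List.prefix_append _ _).isInfix
  · refine D2.mono ?_ (ori_contig c hW)
    have := hp p hW
    unfold ori
    split_ifs
    · rcases hn with hn | hn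
      · exact d2_inter_right hn (by omega)
      · exact d2_inter_left hn (by omega)
    · rcases hn with hn | hn
      · exact d2_inter_left hn (by omega)
      · exact d2_inter_right hn (by omega)

theorem ori_sep (c c' : α → Bool) (bs : List (List α × List α))
    (hp : ∀ p ∈ bs, p.1 ≠ [] ∧ p.1.length = p.2.length) : ∀ (pre : List α), pre ≠ [] →
    (∃ p ∈ bs, col c p.1 ≠ col c' p.1) →
    TriSep (pre ++ bs.flatMap (ori c)) (pre ++ bs.flatMap (ori c')) := by
  induction bs with
  | nil => simp
  | cons b bs ih =>
    intro pre hpre hex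
    by_cases hb : col c b.1 = col c' b.1
    · have e : ori c b = ori c' b := by simp [ori, hb]
      have := ih (fun p h => hp p (List.mem_cons_of_mem _ h)) (pre ++ ori c b) (by simp [hpre])
        (by
          obtain ⟨p, h1, h2⟩ := hex
          rcases List.mem_cons.1 h1 with rfl | h1
          · exact absurd hb h2
          · exact ⟨p, h1, h2⟩)
      simpa [e] using this
    · obtain ⟨X, Y⟩ := b
      obtain ⟨h1, h2⟩ := hp _ List.mem_cons_self
      simp only at h1 h2 hb
      obtain ⟨pre, e, rfl⟩ := concat_of_ne_nil hpre
      cases X with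
      | nil => exact absurd rfl h1
      | cons x X =>
      cases Y with
      | nil => simp at h2
      | cons y Y =>
      have aux : ∀ c c' : α → Bool, col c (x :: X) = true → col c' (x :: X) = false →
          TriSep ((pre ++ [e]) ++ ((x :: X, y :: Y) :: bs).flatMap (ori c))
            ((pre ++ [e]) ++ ((x :: X, y :: Y) :: bs).flatMap (ori c')) := by
        intro c c' hc hc'
        refine ⟨e, x, Or.inr ⟨Or.inl ?_, y, Or.inl ?_⟩⟩
        · simp only [List.flatMap_cons, ori, hc', inter]
          exact ⟨pre, y :: inter X Y ++ bs.flatMap (ori c'), by simp⟩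
        · simp only [List.flatMap_cons, ori, hc, inter]
          exact ⟨pre, inter Y X ++ bs.flatMap (ori c), by simp⟩
      cases hc : col c (x :: X) <;> cases hc' : col c' (x :: X)
      · simp [hc, hc'] at hb
      · exact (aux c' c hc' hc).symm
      · exact aux c c' hc hc'
      · simp [hc, hc'] at hb

/-- The path attached to a colouring. -/
def thePath (c : α → Bool) (l : List α) : List α :=
  pth c (dec c l.length (l.map (fun a => [a])))

theorem thePath_perm (c : α → Bool) (l : List α) : (thePath c l).Perm l := by
  refine (pth_perm _ _).trans ?_
  refine (dec_perm c l.length _ (by simp)).symm.trans ?_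
  rw [← List.flatMap_def]
  simp

theorem good_single (c : α → Bool) (l : List α) : Good c 1 (l.map (fun a => [a])) := by
  intro X hX
  obtain ⟨a, _, rfl⟩ := List.mem_map.1 hX
  simp [col]

theorem thePath_sep (c c' : α → Bool) (l : List α) (hc : bal c (l.map (fun a => [a])) = 1)
    (hc' : bal c' (l.map (fun a => [a])) = 1) (hne : ∃ a ∈ l, c a ≠ c' a) :
    TriSep (thePath c l) (thePath c' l) := by
  have g := dec_good l.length 1 _ one_pos (good_single c l)
  have g' := dec_good l.length 1 _ one_pos (good_single c' l)
  obtain ⟨S, R, e1, e2, e3, e4⟩ :=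
    (dec_lead l.length 1 _ one_pos (good_single c l) (by simp)).2 hc
  obtain ⟨S', R', e1', e2', e3', e4'⟩ :=
    (dec_lead l.length 1 _ one_pos (good_single c' l) (by simp)).2 hc'
  unfold thePath
  by_cases hd : dec c l.length (l.map (fun a => [a])) = dec c' l.length (l.map (fun a => [a]))
  · have hperm := dec_perm c l.length (l.map (fun a => [a])) (by simp)
    rw [← List.flatMap_def, List.flatMap_singleton'] at hperm
    rw [← hd] at g' e1' ⊢
    set d := dec c l.length (l.map (fun a => [a])) with hdd
    obtain ⟨rfl, rfl⟩ : S = S' ∧ R = R' := by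
      have := e1.symm.trans e1'
      simpa using this
    unfold pth
    apply ori_sep
    · exact fun p hp => ⟨(g.2 p hp).1, (g.2 p hp).2.1⟩
    · intro e
      have h1 := (inter_perm (d.1.getLastD []) d.1.dropLast.flatten).length_eq
      rw [e, e1] at h1
      simp at h1
      omega
    · obtain ⟨a, ha, hac⟩ := hne
      rcases List.mem_append.1 (hperm.subset ha) with h | h
      · exfalso
        obtain ⟨W, hW, haW⟩ := List.mem_flatten.1 h
        apply hac
        rw [g.1 W hW a haW, g'.1 W hW a haW]
        rw [e1] at hW
        rcases List.mem_append.1 hW with hW | hW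
        · rw [e2 W hW, e2' W hW]
        · rw [List.mem_singleton] at hW
          subst hW
          rw [e3, e3']
      · obtain ⟨p, hp, hap⟩ := List.mem_flatMap.1 h
        refine ⟨p, hp, ?_⟩
        intro hcol
        apply hac
        obtain ⟨-, -, a1, a2, a3⟩ := g.2 p hp
        obtain ⟨-, -, b1, b2, b3⟩ := g'.2 p hp
        rcases List.mem_append.1 hap with h | h
        · rw [a1 a h, b1 a h, hcol]
        · rw [a2 a h, b2 a h]
          revert a3 b3 hcol
          generalize col c p.1 = u1
          generalize col c p.2 = u2
          generalize col c' p.1 = u3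
          generalize col c' p.2 = u4
          revert u1 u2 u3 u4
          decide
  · obtain ⟨X, Y, x, y, hl, h⟩ := dec_diff l.length 1 _ one_pos (good_single c l)
      (good_single c' l) (by simp) hd
    rcases h with ⟨h1, h2⟩ | ⟨h1, h2⟩
    · exact ⟨x, y, Or.inl ⟨(ori_nb c X Y x y hl).mono (ori_contig c h1),
        comp_d2 c' h2 (fun p hp => (g'.2 p hp).2.1) S' R' e1' e4'⟩⟩
    · exact ⟨x, y, Or.inr ⟨(ori_nb c' X Y x y hl).mono (ori_contig c' h1),
        comp_d2 c h2 (fun p hp => (g.2 p hp).2.1) S R e1 e4⟩⟩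

theorem graph_of_list {n : ℕ} (l : List (Fin n)) (nd : l.Nodup) (h : ∀ x, x ∈ l) :
    ∃ G : SimpleGraph (Fin n), IsHamPathGraph G ∧ ∀ x y, [x, y] <:+: l → G.Adj x y := by
  have hl : l.length = n := by
    have := Fintype.card_congr (nd.getEquivOfForallMemList l h)
    simpa using this
  refine ⟨_, ⟨(finCongr hl.symm).trans (nd.getEquivOfForallMemList l h), rfl⟩, ?_⟩
  rintro x y ⟨s, t, e⟩
  rw [SimpleGraph.map_adj]
  have hlen : s.length + 1 < l.length := by rw [← e]; simp
  refine ⟨⟨s.length, by omega⟩, ⟨s.length + 1, by omega⟩, ?_, ?_, ?_⟩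
  · rw [SimpleGraph.pathGraph_adj]; simp
  · subst e
    simp
  · subst e
    simp

theorem sep_triangle {n : ℕ} {P Q : List (Fin n)} {G H : SimpleGraph (Fin n)}
    (hG : ∀ x y, [x, y] <:+: P → G.Adj x y) (hH : ∀ x y, [x, y] <:+: Q → H.Adj x y)
    (hs : TriSep P Q) :
    ∃ (v : Fin n) (c : (G ⊔ H).Walk v v), c.IsCycle ∧ c.length = 3 := by
  rw [← is3Clique_iff_exists_cycle_length_three]
  simp only [is3Clique_iff]
  have key : ∀ (K : SimpleGraph (Fin n)) (l : List (Fin n)) x z y,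
      (∀ x y, [x, y] <:+: l → K.Adj x y) → [x, z, y] <:+: l → K.Adj x z ∧ K.Adj z y := by
    intro K l x z y hK hl
    exact ⟨hK _ _ (List.IsInfix.trans ⟨[], [y], by simp⟩ hl),
      hK _ _ (List.IsInfix.trans ⟨[x], [], by simp⟩ hl)⟩
  have key2 : ∀ (K : SimpleGraph (Fin n)) (l : List (Fin n)) x y,
      (∀ x y, [x, y] <:+: l → K.Adj x y) → D2 x y l → ∃ z, K.Adj x z ∧ K.Adj z y := by
    rintro K l x y hK ⟨z, h | h⟩
    · exact ⟨z, key K l x z y hK h⟩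
    · exact ⟨z, (key K l y z x hK h).2.symm, (key K l y z x hK h).1.symm⟩
  have key3 : ∀ (K : SimpleGraph (Fin n)) (l : List (Fin n)) x y,
      (∀ x y, [x, y] <:+: l → K.Adj x y) → Nb x y l → K.Adj x y := by
    rintro K l x y hK (h | h)
    · exact hK _ _ h
    · exact (hK _ _ h).symm
  obtain ⟨x, y, ⟨h1, h2⟩ | ⟨h1, h2⟩⟩ := hs
  · obtain ⟨z, a, b⟩ := key2 H Q x y hH h2
    exact ⟨_, x, z, y, Or.inr a, Or.inl (key3 G P x y hG h1), Or.inr b, rfl⟩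
  · obtain ⟨z, a, b⟩ := key2 G P x y hG h2
    exact ⟨_, x, z, y, Or.inl a, Or.inr (key3 H Q x y hH h1), Or.inl b, rfl⟩

theorem no_triangle {n : ℕ} {G H : SimpleGraph (Fin n)} (S : Finset (Fin n))
    (hG : ∀ u v, G.Adj u v → (u ∈ S ↔ v ∉ S)) (hH : ∀ u v, H.Adj u v → (u ∈ S ↔ v ∉ S)) :
    ¬ ∃ (v : Fin n) (c : (G ⊔ H).Walk v v), c.IsCycle ∧ c.length = 3 := by
  rw [← is3Clique_iff_exists_cycle_length_three]
  simp only [is3Clique_iff]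
  rintro ⟨_, a, b, c, h1, h2, h3, -⟩
  have key : ∀ u v, (G ⊔ H).Adj u v → (u ∈ S ↔ v ∉ S) := by
    rintro u v (h | h)
    · exact hG u v h
    · exact hH u v h
  have := key _ _ h1
  have := key _ _ h2
  have := key _ _ h3
  tauto

theorem card_even (n : ℕ) :
    ((Finset.univ : Finset (Fin n)).filter (fun i => i.val % 2 = 0)).card = (n + 1) / 2 := by
  rw [Finset.card_filter, Fin.sum_univ_eq_sum_range (fun i => if i % 2 = 0 then 1 else 0)]
  induction n with
  | zero => simp
  | succ n ih =>
    rw [Finset.sum_range_succ, ih]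
    split_ifs <;> omega

theorem ham_class {n : ℕ} {G : SimpleGraph (Fin n)} (h : IsHamPathGraph G) :
    ∃ S : Finset (Fin n), S.card = (n + 1) / 2 ∧ ∀ u v, G.Adj u v → (u ∈ S ↔ v ∉ S) := by
  obtain ⟨σ, rfl⟩ := h
  refine ⟨(Finset.univ.filter (fun i => i.val % 2 = 0)).map σ.toEmbedding, ?_, ?_⟩
  · rw [Finset.card_map, card_even]
  · intro u v huv
    rw [SimpleGraph.map_adj] at huv
    obtain ⟨a, b, hab, rfl, rfl⟩ := huv
    rw [SimpleGraph.pathGraph_adj] at hab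
    simp
    omega

theorem ham_class_even {k : ℕ} {G : SimpleGraph (Fin (2 * k + 2))} (h : IsHamPathGraph G) :
    ∃ S : Finset (Fin (2 * k + 2)), S ∈ Finset.powersetCard (k + 1)
      (Finset.univ.erase (Fin.last _)) ∧ ∀ u v, G.Adj u v → (u ∈ S ↔ v ∉ S) := by
  obtain ⟨S, h1, h2⟩ := ham_class h
  by_cases hS : Fin.last _ ∈ S
  · refine ⟨Sᶜ, ?_, ?_⟩
    · rw [Finset.mem_powersetCard]
      refine ⟨?_, ?_⟩
      · intro x hx
        simp only [Finset.mem_erase, Finset.mem_univ, and_true]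
        rintro rfl
        simp [hS] at hx
      · rw [Finset.card_compl, h1, Fintype.card_fin]
        omega
    · intro u v huv
      have := h2 u v huv
      simp
      tauto
  · refine ⟨S, ?_, h2⟩
    rw [Finset.mem_powersetCard]
    refine ⟨?_, by omega⟩
    intro x hx
    simp only [Finset.mem_erase, Finset.mem_univ, and_true]
    rintro rfl
    exact hS hx

theorem upper {n : ℕ} (T : Finset (Finset (Fin n))) (F : Finset (SimpleGraph (Fin n)))
    (hF : ∀ G ∈ F, ∃ S ∈ T, ∀ u v, G.Adj u v → (u ∈ S ↔ v ∉ S))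
    (hp : (F : Set (SimpleGraph (Fin n))).Pairwise (fun G H =>
          ∃ (v : Fin n) (c : (G ⊔ H).Walk v v), c.IsCycle ∧ c.length = 3)) :
    F.card ≤ T.card := by
  choose! f hf using hF
  apply Finset.card_le_card_of_injOn f
  · exact fun G hG => (hf G hG).1
  · intro G hG H hH e
    by_contra hne
    refine no_triangle (f G) (hf G hG).2 ?_ (hp hG hH hne)
    rw [e]
    exact (hf H hH).2

theorem lower {ι : Type*} [DecidableEq ι] {n : ℕ} (T : Finset ι) (p : ι → List (Fin n))
    (nd : ∀ i, (p i).Nodup) (hm : ∀ i x, x ∈ p i)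
    (hs : ∀ i ∈ T, ∀ j ∈ T, i ≠ j → TriSep (p i) (p j)) :
    ∃ F : Finset (SimpleGraph (Fin n)),
        (∀ G ∈ F, IsHamPathGraph G) ∧
        (F : Set (SimpleGraph (Fin n))).Pairwise (fun G H =>
          ∃ (v : Fin n) (c : (G ⊔ H).Walk v v), c.IsCycle ∧ c.length = 3) ∧
        F.card = T.card := by
  classical
  choose g hg1 hg2 using fun i => graph_of_list (p i) (nd i) (hm i)
  have key : ∀ i ∈ T, ∀ j ∈ T, i ≠ j →
      ∃ (v : Fin n) (c : (g i ⊔ g j).Walk v v), c.IsCycle ∧ c.length = 3 :=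
    fun i hi j hj hij => sep_triangle (hg2 i) (hg2 j) (hs i hi j hj hij)
  refine ⟨T.image g, ?_, ?_, ?_⟩
  · intro G hG
    obtain ⟨i, _, rfl⟩ := Finset.mem_image.1 hG
    exact hg1 i
  · intro G hG H hH hne
    obtain ⟨i, hi, rfl⟩ := Finset.mem_image.1 hG
    obtain ⟨j, hj, rfl⟩ := Finset.mem_image.1 hH
    exact key i hi j hj (fun e => hne (by rw [e]))
  · apply Finset.card_image_of_injOn
    intro i hi j hj e
    by_contra hne
    obtain ⟨S, -, hS⟩ := ham_class (hg1 i)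
    exact no_triangle S hS (by rw [← e]; exact hS) (key i hi j hj hne)

def oddPath {n : ℕ} (S : Finset (Fin n)) : List (Fin n) :=
  thePath (fun a => decide (a ∈ S)) (List.finRange n)

theorem oddPath_nodup {n : ℕ} (S : Finset (Fin n)) : (oddPath S).Nodup :=
  (thePath_perm _ _).nodup_iff.2 (List.nodup_finRange n)

theorem oddPath_mem {n : ℕ} (S : Finset (Fin n)) (x : Fin n) : x ∈ oddPath S :=
  (thePath_perm _ _).mem_iff.2 (List.mem_finRange x)

theorem bal_finset {k : ℕ} (S : Finset (Fin (2 * k + 1))) (hS : S.card = k + 1) :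
    bal (fun a => decide (a ∈ S)) ((List.finRange (2 * k + 1)).map (fun a => [a])) = 1 := by
  have h1 : bal (fun a => decide (a ∈ S)) ((List.finRange (2 * k + 1)).map (fun a => [a])) =
      ∑ a : Fin (2 * k + 1), if a ∈ S then (1 : ℤ) else -1 := by
    rw [bal, List.map_map, Fin.sum_univ_def]
    congr 1
    apply List.map_congr_left
    intro a _
    simp [col]
  rw [h1]
  have h2 : ∀ a : Fin (2 * k + 1), (if a ∈ S then (1 : ℤ) else -1) =
      2 * (if a ∈ S then (1 : ℤ) else 0) - 1 := by
    intro a; split_ifs <;> norm_num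
  rw [Finset.sum_congr rfl (fun a _ => h2 a), Finset.sum_sub_distrib, ← Finset.mul_sum]
  simp [hS]
  ring

theorem oddPath_sep {k : ℕ} (S S' : Finset (Fin (2 * k + 1))) (hS : S.card = k + 1)
    (hS' : S'.card = k + 1) (hne : S ≠ S') : TriSep (oddPath S) (oddPath S') := by
  apply thePath_sep _ _ _ (bal_finset S hS) (bal_finset S' hS')
  by_contra! h
  apply hne
  ext a
  simpa using h a (List.mem_finRange a)

theorem TriSep.map_append {α β : Type*} {P Q : List α} (h : TriSep P Q) (f : α → β) (t : List β) :
    TriSep (P.map f ++ t) (Q.map f ++ t) := by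
  have key : ∀ (a l : List α), a <:+: l → a.map f <:+: l.map f ++ t := by
    intro a l h
    exact (h.map f).trans (List.prefix_append _ _).isInfix
  have k1 : ∀ (l : List α) x y, Nb x y l → Nb (f x) (f y) (l.map f ++ t) := by
    rintro l x y h
    exact h.imp (fun h => by simpa using key _ _ h) (fun h => by simpa using key _ _ h)
  have k2 : ∀ (l : List α) x y, D2 x y l → D2 (f x) (f y) (l.map f ++ t) := by
    rintro l x y ⟨z, h⟩
    exact ⟨f z, h.imp (fun h => by simpa using key _ _ h) (fun h => by simpa using key _ _ h)⟩
  obtain ⟨x, y, h⟩ := h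
  exact ⟨f x, f y, h.imp (fun h => ⟨k1 _ _ _ h.1, k2 _ _ _ h.2⟩)
    (fun h => ⟨k1 _ _ _ h.1, k2 _ _ _ h.2⟩)⟩

end TrianglePaths

theorem max_triangle_separated_ham_paths (n : ℕ) (hn : 2 ≤ n) :
    IsGreatest {m : ℕ | ∃ F : Finset (SimpleGraph (Fin n)),
        (∀ G ∈ F, IsHamPathGraph G) ∧
        (F : Set (SimpleGraph (Fin n))).Pairwise (fun G H =>
          ∃ (v : Fin n) (c : (G ⊔ H).Walk v v), c.IsCycle ∧ c.length = 3) ∧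
        F.card = m}
      (if Odd n then n.choose ((n - 1) / 2) else n.choose (n / 2) / 2) := by
  have hT : ∀ k : ℕ, (Finset.powersetCard (k + 1) (Finset.univ : Finset (Fin (2 * k + 1)))).card
      = (2 * k + 1).choose k := by
    intro k
    rw [Finset.card_powersetCard, Finset.card_univ, Fintype.card_fin, Nat.choose_symm_half]
  split_ifs with hodd
  · obtain ⟨k, rfl⟩ := hodd
    have e : (2 * k + 1 - 1) / 2 = k := by omega
    rw [e, ← hT k]
    constructor
    · apply lower _ oddPath oddPath_nodup oddPath_mem
      intro S hS S' hS' hne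
      exact oddPath_sep S S' (Finset.mem_powersetCard.1 hS).2 (Finset.mem_powersetCard.1 hS').2 hne
    · rintro m ⟨F, hF, hp, rfl⟩
      apply upper _ F _ hp
      intro G hG
      obtain ⟨S, h1, h2⟩ := ham_class (hF G hG)
      exact ⟨S, Finset.mem_powersetCard.2 ⟨Finset.subset_univ _, by omega⟩, h2⟩
  · obtain ⟨k, rfl⟩ : ∃ k, n = 2 * k + 2 := by
      rw [Nat.not_odd_iff_even] at hodd
      obtain ⟨r, rfl⟩ := hodd
      exact ⟨r - 1, by omega⟩
    have e : (2 * k + 2).choose ((2 * k + 2) / 2) / 2 = (2 * k + 1).choose k := by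
      have e1 : (2 * k + 2) / 2 = k + 1 := by omega
      rw [e1, Nat.choose_succ_succ, Nat.choose_symm_half]
      omega
    rw [e]
    constructor
    · rw [← hT k]
      apply lower _ (fun S => (oddPath S).map Fin.castSucc ++ [Fin.last (2 * k + 1)])
      · intro S
        rw [List.nodup_append]
        refine ⟨(oddPath_nodup S).map (Fin.castSucc_injective _), by simp, ?_⟩
        intro a ha b hb
        obtain ⟨a, _, rfl⟩ := List.mem_map.1 ha
        rw [List.mem_singleton] at hb
        subst hb
        exact (Fin.castSucc_lt_last a).ne
      · intro S x
        induction x using Fin.lastCases with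
        | last => simp
        | cast i => exact List.mem_append_left _ (List.mem_map_of_mem (oddPath_mem S i))
      · intro S hS S' hS' hne
        exact (oddPath_sep S S' (Finset.mem_powersetCard.1 hS).2
          (Finset.mem_powersetCard.1 hS').2 hne).map_append _ _
    · rintro m ⟨F, hF, hp, rfl⟩
      have := upper (Finset.powersetCard (k + 1) (Finset.univ.erase (Fin.last (2 * k + 1)))) F
        (fun G hG => ham_class_even (hF G hG)) hp
      rw [Finset.card_powersetCard, Finset.card_erase_of_mem (Finset.mem_univ _), Finset.card_univ,
        Fintype.card_fin] at this
      rw [← Nat.choose_symm_half]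
      exact this
end

section
/- For every odd integer n ≥ 3, there exists a family F of n Hamiltonian paths of the complete graph K_n such that the intersection graph of F — the graph whose vertices are the members of F, with two members adjacent exactly when they share an edge of K_n — is a cycle of length n. -/
open SimpleGraph

/-- The zigzag integer sequence 0, 1, -1, 2, -2, ... -/
def zigzag (k : ℕ) : ℤ := if k % 2 = 0 then -((k / 2 : ℕ) : ℤ) else (((k + 1) / 2 : ℕ) : ℤ)

lemma zigzag_cases (k : ℕ) : (k % 2 = 0 ∧ 2 * zigzag k = -(k : ℤ)) ∨
    (k % 2 = 1 ∧ 2 * zigzag k = (k : ℤ) + 1) := by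
  unfold zigzag
  split_ifs with h
  · left; omega
  · right; omega

lemma cast_eq_zero_small (m : ℕ) (x : ℤ) :
    ((x : ℤ) : ZMod (2 * m + 1)) = 0 ↔ ∃ t : ℤ, x = (2 * m + 1) * t := by
  rw [ZMod.intCast_zmod_eq_zero_iff_dvd]
  push_cast
  rfl

lemma zmod_half (m : ℕ) (s : ZMod (2 * m + 1)) : s * (m + 1) + s * (m + 1) = s := by
  have h : ((2 * m + 1 : ℕ) : ZMod (2 * m + 1)) = 0 := ZMod.natCast_self _
  push_cast at h
  linear_combination s * h

/-- Vertices joined when their sum is `i` or `i + 1`. -/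
def sumGraph (m : ℕ) (i : ZMod (2 * m + 1)) : SimpleGraph (ZMod (2 * m + 1)) where
  Adj a b := a ≠ b ∧ (a + b = i ∨ a + b = i + 1)
  symm := ⟨fun a b h => ⟨h.1.symm, by rw [add_comm b a]; exact h.2⟩⟩
  loopless := ⟨fun a h => h.1 rfl⟩

def zigMap (m : ℕ) (i : ZMod (2 * m + 1)) (k : Fin (2 * m + 1)) : ZMod (2 * m + 1) :=
  i * (m + 1) + (zigzag k.val : ℤ)

lemma small_multiple {m : ℕ} {x t : ℤ} (h : x = (2 * m + 1) * t) (h1 : x < 2 * m + 1)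
    (h2 : -(2 * m + 1) < x) : x = 0 := by
  have a : t < 1 := by by_contra hc; push Not at hc; nlinarith
  have b : -1 < t := by by_contra hc; push Not at hc; nlinarith
  have : t = 0 := by omega
  simp [h, this]

lemma zigMap_inj (m : ℕ) (i : ZMod (2 * m + 1)) : Function.Injective (zigMap m i) := by
  intro k l h
  have h' : (((zigzag k.val - zigzag l.val : ℤ)) : ZMod (2 * m + 1)) = 0 := by
    unfold zigMap at h
    push_cast
    linear_combination h
  obtain ⟨t, ht⟩ := (cast_eq_zero_small m _).1 h'
  have hk := zigzag_cases k.val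
  have hl := zigzag_cases l.val
  have k2 := k.isLt
  have l2 := l.isLt
  have := small_multiple ht (by omega) (by omega)
  ext
  omega

lemma zigMap_adj (m : ℕ) (i : ZMod (2 * m + 1)) (k l : Fin (2 * m + 1)) :
    (sumGraph m i).Adj (zigMap m i k) (zigMap m i l) ↔ (pathGraph (2 * m + 1)).Adj k l := by
  rw [pathGraph_adj]
  have hk := zigzag_cases k.val
  have hl := zigzag_cases l.val
  have k2 := k.isLt
  have l2 := l.isLt
  have hh := zmod_half m i
  have e0 : zigMap m i k + zigMap m i l = i + ((zigzag k.val + zigzag l.val : ℤ) : ZMod (2 * m + 1)) := by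
    unfold zigMap; push_cast; linear_combination hh
  change (zigMap m i k ≠ zigMap m i l ∧ (_ ∨ _)) ↔ _
  rw [(zigMap_inj m i).ne_iff, e0, Ne, Fin.ext_iff]
  constructor
  · rintro ⟨hne, h | h⟩
    · obtain ⟨t, ht⟩ := (cast_eq_zero_small m (zigzag k.val + zigzag l.val)).1
        (by linear_combination h)
      have := small_multiple ht (by omega) (by omega)
      omega
    · obtain ⟨t, ht⟩ := (cast_eq_zero_small m (zigzag k.val + zigzag l.val - 1)).1
        (by push_cast; push_cast at h; linear_combination h)
      have := small_multiple ht (by omega) (by omega)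
      omega
  · intro h
    refine ⟨by omega, ?_⟩
    have : zigzag k.val + zigzag l.val = 0 ∨ zigzag k.val + zigzag l.val = 1 := by omega
    rcases this with h | h
    · left; rw [h]; simp
    · right; rw [h]; simp

lemma sumGraph_ham (m : ℕ) (i : ZMod (2 * m + 1)) :
    IsHamPathGraph (n := 2 * m + 1) (sumGraph m i) := by
  have hb : Function.Bijective (α := Fin (2 * m + 1)) (β := Fin (2 * m + 1)) (zigMap m i) :=
    Finite.injective_iff_bijective.1 (zigMap_inj m i)
  refine ⟨Equiv.ofBijective _ hb, ?_⟩
  ext a b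
  obtain ⟨k, rfl⟩ := hb.2 a
  obtain ⟨l, rfl⟩ := hb.2 b
  refine (zigMap_adj m i k l).trans ?_
  exact (SimpleGraph.map_adj_apply (f := (Equiv.ofBijective _ hb).toEmbedding)).symm

lemma two_ne (m : ℕ) (hm : 1 ≤ m) : (2 : ZMod (2 * m + 1)) ≠ 0 := by
  intro h
  obtain ⟨t, ht⟩ := (cast_eq_zero_small m 2).1 (by exact_mod_cast h)
  have := small_multiple ht (by omega) (by omega)
  omega

lemma sum_witness (m : ℕ) (hm : 1 ≤ m) (s : ZMod (2 * m + 1)) : ∃ a b, a ≠ b ∧ a + b = s := by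
  by_cases hs : s = 0
  · refine ⟨1, -1, ?_, by simp [hs]⟩
    intro h
    exact two_ne m hm (by linear_combination h)
  · exact ⟨s, 0, hs, by simp⟩

lemma sumGraph_disj (m : ℕ) (hm : 1 ≤ m) (i j : ZMod (2 * m + 1)) (hij : i ≠ j) :
    ¬ Disjoint (sumGraph m i).edgeSet (sumGraph m j).edgeSet ↔ (i - j = 1 ∨ j - i = 1) := by
  rw [Set.not_disjoint_iff]
  constructor
  · rintro ⟨e, h1, h2⟩
    induction e with
    | _ a b =>
    obtain ⟨_, h1⟩ := h1
    obtain ⟨_, h2⟩ := h2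
    rcases h1 with h1 | h1 <;> rcases h2 with h2 | h2
    · exact absurd (h1.symm.trans h2) hij
    · left; linear_combination h2 - h1
    · right; linear_combination h1 - h2
    · exact absurd (add_right_cancel (h1.symm.trans h2)) hij
  · rintro (h | h)
    · obtain ⟨a, b, hab, hs⟩ := sum_witness m hm i
      exact ⟨s(a, b), ⟨hab, Or.inl hs⟩, ⟨hab, Or.inr (by linear_combination hs + h)⟩⟩
    · obtain ⟨a, b, hab, hs⟩ := sum_witness m hm j
      exact ⟨s(a, b), ⟨hab, Or.inr (by linear_combination hs + h)⟩, ⟨hab, Or.inl hs⟩⟩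

lemma sumGraph_step (m : ℕ) (hm : 1 ≤ m) (i : ZMod (2 * m + 1)) :
    sumGraph m i ≠ sumGraph m (i + 1) := by
  intro h
  obtain ⟨a, b, hab, hs⟩ := sum_witness m hm i
  have h1 : (sumGraph m i).Adj a b := ⟨hab, Or.inl hs⟩
  rw [h] at h1
  rcases h1.2 with h2 | h2
  · exact two_ne m hm (by linear_combination 2 * (hs - h2))
  · exact two_ne m hm (by linear_combination hs - h2)

lemma sumGraph_inj (m : ℕ) (hm : 1 ≤ m) : Function.Injective (sumGraph m) := by
  intro i j h
  by_contra hij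
  have hd : ¬ Disjoint (sumGraph m i).edgeSet (sumGraph m j).edgeSet := by
    rw [← h, Set.not_disjoint_iff]
    obtain ⟨a, b, hab, hs⟩ := sum_witness m hm i
    exact ⟨s(a, b), ⟨hab, Or.inl hs⟩, ⟨hab, Or.inl hs⟩⟩
  rcases (sumGraph_disj m hm i j hij).1 hd with h1 | h1
  · obtain rfl : i = j + 1 := by linear_combination h1
    exact sumGraph_step m hm j h.symm
  · obtain rfl : j = i + 1 := by linear_combination h1
    exact sumGraph_step m hm i h

theorem ham_paths_with_cycle_intersection_graph (n : ℕ) (hn : 3 ≤ n) (hno : Odd n) :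
    ∃ f : Fin n → SimpleGraph (Fin n),
      Function.Injective f ∧
      (∀ i, IsHamPathGraph (f i)) ∧
      ∀ i j, i ≠ j →
        (¬ Disjoint (f i).edgeSet (f j).edgeSet ↔ (cycleGraph n).Adj i j) := by
  obtain ⟨m, rfl⟩ := hno
  obtain ⟨p, rfl⟩ : ∃ p, m = p + 1 := ⟨m - 1, by omega⟩
  refine ⟨sumGraph (p + 1), sumGraph_inj _ (by omega), sumGraph_ham _, ?_⟩
  intro i j hij
  refine (sumGraph_disj (p + 1) (by omega) i j hij).trans ?_
  exact (cycleGraph_adj (n := 2 * p + 1) (u := i) (v := j)).symm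
end

section
/- For every fixed positive integer ℓ, let Q(n) denote the maximum number of Hamiltonian paths of the complete graph K_n such that the union of every two distinct paths in the family contains a cycle of length 2^ℓ + 1. Then Q(n)^{1/n} tends to 2 as n tends to infinity; in particular Q(n) = 2^{n − o(n)}. -/
open SimpleGraph

/-- `hamQ ℓ n`: the maximum number of Hamiltonian paths of `K_n` such that the union of
every two distinct paths in the family contains a cycle of length `2 ^ ℓ + 1`. -/
noncomputable def hamQ (ℓ n : ℕ) : ℕ :=
  sSup {m : ℕ | ∃ F : Finset (SimpleGraph (Fin n)),
    (∀ G ∈ F, IsHamPathGraph G) ∧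
    (F : Set (SimpleGraph (Fin n))).Pairwise (fun G H =>
      ∃ (v : Fin n) (c : (G ⊔ H).Walk v v), c.IsCycle ∧ c.length = 2 ^ ℓ + 1) ∧
    F.card = m}


/-- Two naturals at distance exactly `d`. -/
def DistEq (d a b : ℕ) : Prop := a = b + d ∨ b = a + d

/-- Separation of two position functions. -/
def SepPos {V : Type} (D : ℕ) (f g : V → ℕ) : Prop :=
  ∃ x y, (DistEq 1 (f x) (f y) ∧ DistEq D (g x) (g y)) ∨
    (DistEq 1 (g x) (g y) ∧ DistEq D (f x) (f y))

/-- The vertices are partitioned into an initial block (id `0`, length `p`) and grids with ids in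
`A`; the grid `t` has `m t` rows and `w t` columns. -/
structure GridInv {V : Type} (A : Finset ℕ) (m w : ℕ → ℕ) (p : ℕ) (T I J : V → ℕ) : Prop where
  zero_notMem : 0 ∉ A
  ppos : 0 < p
  inj : ∀ x y, T x = T y → I x = I y → J x = J y → x = y
  range : ∀ x, (T x = 0 ∧ I x < p ∧ J x = 0) ∨ (T x ∈ A ∧ I x < m (T x) ∧ J x < w (T x))
  surj0 : ∀ k, k < p → ∃ x, T x = 0 ∧ I x = k
  surj : ∀ t ∈ A, ∀ i j, i < m t → j < w t → ∃ x, T x = t ∧ I x = i ∧ J x = j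

/-- A position function respecting the grid structure. -/
structure Resp {V : Type} (D : ℕ) (T I J : V → ℕ) (f : V → ℕ) : Prop where
  zero : ∀ x, T x = 0 → f x = I x
  hor : ∀ x y, T x ≠ 0 → T x = T y → I x = I y → J y = J x + 1 → DistEq 1 (f x) (f y)
  ver : ∀ x y, T x ≠ 0 → T x = T y → J x = J y → I y = I x + 1 → DistEq D (f x) (f y)

theorem DistEq.symm {d a b : ℕ} (h : DistEq d a b) : DistEq d b a := Or.symm h

section merge
variable {V : Type} {A : Finset ℕ} {m w : ℕ → ℕ} {p : ℕ} {T I J : V → ℕ}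

/-- vertical merge -/
theorem GridInv.vert (H : GridInv A m w p T I J) {g h : ℕ} (hg : g ∈ A) (hh : h ∈ A) (hne : g ≠ h)
    (hm : m g = m h) (hw : w g = w h) :
    GridInv (A.erase h) (Function.update m g (2 * m g)) w p
      (fun x => if T x = h then g else T x) (fun x => if T x = h then m g + I x else I x) J := by
  have h0 := H.zero_notMem
  have hg0 : g ≠ 0 := fun h => h0 (h ▸ hg)
  have hh0 : h ≠ 0 := fun h => h0 (h ▸ hh)
  refine ⟨by simp [h0], H.ppos, ?_, ?_, ?_, ?_⟩
  · intro x y h1 h2 h3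
    have rx := H.range x
    have ry := H.range y
    apply H.inj x y _ _ h3 <;> grind
  · intro x
    have rx := H.range x
    simp only [Finset.mem_erase, Function.update_apply]
    grind
  · intro k hk
    obtain ⟨x, hx, hx'⟩ := H.surj0 k hk
    exact ⟨x, by grind⟩
  · intro t ht i j hi hj
    rw [Finset.mem_erase] at ht
    by_cases htg : t = g
    · subst htg
      simp only [Function.update_self] at hi
      by_cases him : i < m t
      · obtain ⟨x, hx⟩ := H.surj t hg i j him hj
        exact ⟨x, by grind⟩
      · obtain ⟨x, hx⟩ := H.surj h hh (i - m t) j (by omega) (by omega)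
        exact ⟨x, by grind⟩
    · rw [Function.update_of_ne htg] at hi
      obtain ⟨x, hx⟩ := H.surj t ht.2 i j hi hj
      exact ⟨x, by grind⟩

theorem Resp.of_vert {D : ℕ} {f : V → ℕ} {g h : ℕ} {c : ℕ} (hg0 : g ≠ 0) (hh0 : h ≠ 0)
    (R : Resp D (fun x => if T x = h then g else T x) (fun x => if T x = h then c + I x else I x) J f) :
    Resp D T I J f := by
  refine ⟨fun x hx => ?_, fun x y h1 h2 h3 h4 => ?_, fun x y h1 h2 h3 h4 => ?_⟩
  · have := R.zero x; grind
  · have := R.hor x y; grind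
  · have := R.ver x y; grind

/-- horizontal merge -/
theorem GridInv.horz (H : GridInv A m w p T I J) {g h : ℕ} (hg : g ∈ A) (hh : h ∈ A) (hne : g ≠ h)
    (hm : m g = m h) (hw : w g = w h) :
    GridInv (A.erase h) m (Function.update w g (2 * w g)) p
      (fun x => if T x = h then g else T x) (fun x => if T x = h then m g - 1 - I x else I x)
      (fun x => if T x = h then 2 * w g - 1 - J x else J x) := by
  have h0 := H.zero_notMem
  have hg0 : g ≠ 0 := fun h => h0 (h ▸ hg)
  have hh0 : h ≠ 0 := fun h => h0 (h ▸ hh)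
  refine ⟨by simp [h0], H.ppos, ?_, ?_, ?_, ?_⟩
  · intro x y h1 h2 h3
    have rx := H.range x
    have ry := H.range y
    apply H.inj x y <;> grind
  · intro x
    have rx := H.range x
    simp only [Finset.mem_erase, Function.update_apply]
    grind
  · intro k hk
    obtain ⟨x, hx, hx'⟩ := H.surj0 k hk
    exact ⟨x, by grind⟩
  · intro t ht i j hi hj
    rw [Finset.mem_erase] at ht
    by_cases htg : t = g
    · subst htg
      simp only [Function.update_self] at hj
      by_cases him : j < w t
      · obtain ⟨x, hx⟩ := H.surj t hg i j hi him
        exact ⟨x, by grind⟩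
      · obtain ⟨x, hx⟩ := H.surj h hh (m t - 1 - i) (2 * w t - 1 - j) (by omega) (by omega)
        exact ⟨x, by grind⟩
    · rw [Function.update_of_ne htg] at hj
      obtain ⟨x, hx⟩ := H.surj t ht.2 i j hi hj
      exact ⟨x, by grind⟩

theorem Resp.of_horz {D : ℕ} {f : V → ℕ} {g h : ℕ} (H : GridInv A m w p T I J)
    (hg : g ∈ A) (hh : h ∈ A) (hm : m g = m h) (hw : w g = w h)
    (R : Resp D (fun x => if T x = h then g else T x)
      (fun x => if T x = h then m g - 1 - I x else I x)
      (fun x => if T x = h then 2 * w g - 1 - J x else J x) f) :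
    Resp D T I J f := by
  have h0 := H.zero_notMem
  have hg0 : g ≠ 0 := fun h => h0 (h ▸ hg)
  have hh0 : h ≠ 0 := fun h => h0 (h ▸ hh)
  refine ⟨fun x hx => ?_, fun x y h1 h2 h3 h4 => ?_, fun x y h1 h2 h3 h4 => ?_⟩
  · have := R.zero x; grind
  · have rx := H.range x
    have ry := H.range y
    by_cases hx : T x = h
    · apply DistEq.symm; apply R.hor y x <;> grind
    · apply R.hor x y <;> grind
  · have rx := H.range x
    have ry := H.range y
    by_cases hx : T x = h
    · apply DistEq.symm; apply R.ver y x <;> grind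
    · apply R.ver x y <;> grind

/-- The pair separating the two merges. -/
theorem GridInv.sep_merge (H : GridInv A m w p T I J) {D g h : ℕ} (hg : g ∈ A) (hh : h ∈ A)
    (hne : g ≠ h) (hm : m g = m h) (hw : w g = w h) (hmp : 0 < m g) (hwp : 0 < w g)
    {f f' : V → ℕ}
    (R : Resp D (fun x => if T x = h then g else T x)
      (fun x => if T x = h then m g + I x else I x) J f)
    (R' : Resp D (fun x => if T x = h then g else T x)
      (fun x => if T x = h then m g - 1 - I x else I x)
      (fun x => if T x = h then 2 * w g - 1 - J x else J x) f') : SepPos D f f' := by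
  have h0 := H.zero_notMem
  have hg0 : g ≠ 0 := fun h => h0 (h ▸ hg)
  have hh0 : h ≠ 0 := fun h => h0 (h ▸ hh)
  obtain ⟨x, hx1, hx2, hx3⟩ := H.surj g hg (m g - 1) (w g - 1) (by omega) (by omega)
  obtain ⟨y, hy1, hy2, hy3⟩ := H.surj h hh 0 (w g - 1) (by omega) (by omega)
  refine ⟨x, y, Or.inr ⟨?_, ?_⟩⟩
  · apply R'.hor x y <;> grind
  · apply R.ver x y <;> grind

/-- absorb grid `g` of width `D` in the initial block; `F` is `J` or its reversal. -/
theorem GridInv.absorb (H : GridInv A m w p T I J) {D g : ℕ} (hD : 0 < D) (hg : g ∈ A)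
    (hw : w g = D) (F : ℕ → ℕ) (hF : ∀ j < D, F j < D) (hF2 : ∀ j < D, F (F j) = j) :
    GridInv (A.erase g) m w (p + D * m g)
      (fun x => if T x = g then 0 else T x)
      (fun x => if T x = g then p + D * I x + F (J x) else I x)
      (fun x => if T x = g then 0 else J x) := by
  have h0 := H.zero_notMem
  have hg0 : g ≠ 0 := fun h => h0 (h ▸ hg)
  have hpp := H.ppos
  have key : ∀ i j, i < m g → j < D → D * i + j < D * m g := by
    intro i j hi hj
    calc D * i + j < D * i + D := by omega
      _ = D * (i + 1) := by ring
      _ ≤ D * m g := Nat.mul_le_mul_left _ hi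
  refine ⟨by simp [h0], by omega, ?_, ?_, ?_, ?_⟩
  · intro x y h1 h2 h3
    have rx := H.range x
    have ry := H.range y
    by_cases hx : T x = g <;> by_cases hy : T y = g
    · simp only [hx, hy, if_true] at h2
      have jx : J x < D := by grind
      have jy : J y < D := by grind
      have e : D * I x + F (J x) = D * I y + F (J y) := by omega
      have e1 := congrArg (· / D) e
      have e2 := congrArg (· % D) e
      simp only [Nat.mul_add_div hD, Nat.div_eq_of_lt (hF _ jx), Nat.div_eq_of_lt (hF _ jy),
        Nat.mul_add_mod, Nat.mod_eq_of_lt (hF _ jx), Nat.mod_eq_of_lt (hF _ jy)] at e1 e2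
      have e3 := congrArg F e2
      rw [hF2 _ jx, hF2 _ jy] at e3
      exact H.inj x y (by omega) (by omega) e3
    · simp only [hx, hy, if_true, if_false] at h1 h2
      grind
    · simp only [hx, hy, if_true, if_false] at h1 h2
      grind
    · apply H.inj x y <;> grind
  · intro x
    have rx := H.range x
    simp only [Finset.mem_erase]
    by_cases hx : T x = g
    · have := key (I x) (F (J x)) (by grind) (hF _ (by grind))
      simp only [hx, if_true]
      exact Or.inl ⟨trivial, by omega, trivial⟩
    · simp only [hx, if_false]
      rcases rx with rx | rx
      · left; omega
      · right; exact ⟨⟨hx, rx.1⟩, rx.2⟩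
  · intro k hk
    by_cases hkp : k < p
    · obtain ⟨x, hx, hx'⟩ := H.surj0 k hkp
      exact ⟨x, by grind⟩
    · have h1 : (k - p) / D < m g := Nat.div_lt_of_lt_mul (by omega)
      have h2 : (k - p) % D < D := Nat.mod_lt _ hD
      obtain ⟨x, hx⟩ := H.surj g hg ((k - p) / D) (F ((k - p) % D)) h1 (hw ▸ hF _ h2)
      have := Nat.div_add_mod (k - p) D
      refine ⟨x, by simp [hx.1], ?_⟩
      simp only [hx.1, if_true, hx.2.1, hx.2.2, hF2 _ h2]
      omega
  · intro t ht i j hi hj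
    rw [Finset.mem_erase] at ht
    obtain ⟨x, hx⟩ := H.surj t ht.2 i j hi hj
    exact ⟨x, by grind⟩

theorem Resp.of_absorb {D g : ℕ} {f : V → ℕ} (H : GridInv A m w p T I J) (hg : g ∈ A)
    (hw : w g = D) (F : ℕ → ℕ) (hF1 : ∀ j, j + 1 < D → DistEq 1 (F j) (F (j + 1)))
    (R : Resp D (fun x => if T x = g then 0 else T x)
      (fun x => if T x = g then p + D * I x + F (J x) else I x)
      (fun x => if T x = g then 0 else J x) f) : Resp D T I J f := by
  have h0 := H.zero_notMem
  have hg0 : g ≠ 0 := fun h => h0 (h ▸ hg)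
  refine ⟨fun x hx => ?_, fun x y h1 h2 h3 h4 => ?_, fun x y h1 h2 h3 h4 => ?_⟩
  · have := R.zero x; grind
  · by_cases hx : T x = g
    · have rx := R.zero x (by simp [hx])
      have ry := R.zero y (by simp [← h2, hx])
      have := H.range y
      have := hF1 (J x) (by grind)
      simp only [hx, ← h2, if_true] at rx ry
      rw [rx, ry, h3, h4]
      unfold DistEq at *
      omega
    · apply R.hor x y <;> grind
  · by_cases hx : T x = g
    · have rx := R.zero x (by simp [hx])
      have ry := R.zero y (by simp [← h2, hx])
      simp only [hx, ← h2, if_true] at rx ry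
      rw [rx, ry, h3, h4]
      right; ring
    · apply R.ver x y <;> grind

theorem GridInv.sep_absorb (H : GridInv A m w p T I J) {D g : ℕ} (hD : 0 < D) (hg : g ∈ A)
    (hw : w g = D) (hmp : 0 < m g) {f f' : V → ℕ}
    (R : Resp D (fun x => if T x = g then 0 else T x)
      (fun x => if T x = g then p + D * I x + J x else I x)
      (fun x => if T x = g then 0 else J x) f)
    (R' : Resp D (fun x => if T x = g then 0 else T x)
      (fun x => if T x = g then p + D * I x + (D - 1 - J x) else I x)
      (fun x => if T x = g then 0 else J x) f') : SepPos D f f' := by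
  have h0 := H.zero_notMem
  have hg0 : g ≠ 0 := fun h => h0 (h ▸ hg)
  have hpp := H.ppos
  obtain ⟨x, hx1, hx2⟩ := H.surj0 (p - 1) (by omega)
  obtain ⟨y, hy1, hy2, hy3⟩ := H.surj g hg 0 0 hmp (by omega)
  have a1 := R.zero x (by simp [hx1])
  have a2 := R.zero y (by simp [hy1])
  have b1 := R'.zero x (by simp [hx1])
  have b2 := R'.zero y (by simp [hy1])
  simp only [hx1, hg0.symm, if_false, hx2, hy1, hy2, hy3, if_true] at a1 a2 b1 b2
  refine ⟨x, y, Or.inl ⟨Or.inr ?_, Or.inr ?_⟩⟩ <;> simp at * <;> omega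
end merge

/-- terminal configuration -/
theorem grid_terminal {V : Type} [Fintype V] (ℓ α : ℕ) {A : Finset ℕ} {a b : ℕ → ℕ} {p : ℕ}
    {T I J : V → ℕ}
    (H : GridInv A (fun t => 2 ^ a t) (fun t => 2 ^ b t) p T I J)
    (ha : ∀ t ∈ A, a t ≤ α) (hb : ∀ t ∈ A, b t < ℓ)
    (hd : ∀ g ∈ A, ∀ h ∈ A, a g = a h → b g = b h → g = h) :
    ∃ f : V → ℕ, Function.Injective f ∧ Resp (2 ^ ℓ) T I J f ∧
      ∀ x, f x < Fintype.card V + (α + 1) * ℓ * (2 ^ α * 2 ^ ℓ) := by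
  have h0 := H.zero_notMem
  have hp : p ≤ Fintype.card V := by
    obtain ⟨x0, -⟩ := H.surj0 0 H.ppos
    have : Nonempty V := ⟨x0⟩
    choose! u hu using H.surj0
    have : Function.Injective (fun k : Fin p => u k) := by
      intro k k' hk
      have e1 := (hu k k.2).2
      have e2 := (hu k' k'.2).2
      simp only at hk
      rw [hk] at e1
      exact Fin.ext (by omega)
    simpa using Fintype.card_le_of_injective _ this
  set D := 2 ^ ℓ with hD
  set M := 2 ^ α with hM
  have hDp : 0 < D := by positivity
  have hMp : 0 < M := by positivity
  -- bounds for grid vertices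
  have key : ∀ x, T x ∈ A → D * I x + J x < M * D ∧ J x < D := by
    intro x hx
    rcases H.range x with r | r
    · exact absurd (r.1 ▸ hx) h0
    · have h1 : 2 ^ a (T x) ≤ M := Nat.pow_le_pow_right (by norm_num) (ha _ hx)
      have h2 : 2 ^ b (T x) ≤ D := Nat.pow_le_pow_right (by norm_num) (hb _ hx).le
      have h3 : I x + 1 ≤ M := by have := r.2.1; omega
      have h4 : J x < D := by have := r.2.2; omega
      refine ⟨?_, h4⟩
      calc D * I x + J x < D * (I x + 1) := by rw [mul_add]; omega
        _ ≤ D * M := Nat.mul_le_mul_left _ h3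
        _ = M * D := by ring
  refine ⟨fun x => if T x = 0 then I x else
    p + ((M * D) * (ℓ * a (T x) + b (T x)) + (D * I x + J x)), ?_, ?_, ?_⟩
  · intro x y hxy
    simp only at hxy
    rcases H.range x with r | r <;> rcases H.range y with r' | r'
    · simp only [r.1, r'.1, if_true] at hxy
      exact H.inj x y (by omega) hxy (by omega)
    · have : T y ≠ 0 := fun h => h0 (h ▸ r'.1)
      simp only [r.1, this, if_true, if_false] at hxy
      omega
    · have : T x ≠ 0 := fun h => h0 (h ▸ r.1)
      simp only [r'.1, this, if_true, if_false] at hxy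
      omega
    · have n1 : T y ≠ 0 := fun h => h0 (h ▸ r'.1)
      have n2 : T x ≠ 0 := fun h => h0 (h ▸ r.1)
      simp only [n1, n2, if_false] at hxy
      have dm : ∀ (K q r q' r' : ℕ), r < K → r' < K → K * q + r = K * q' + r' →
          q = q' ∧ r = r' := by
        intro K q r q' r' h1 h2 e
        have hK : 0 < K := by omega
        have e1 := congrArg (· / K) e
        have e2 := congrArg (· % K) e
        simp only [Nat.mul_add_div hK, Nat.div_eq_of_lt h1, Nat.div_eq_of_lt h2,
          Nat.mul_add_mod, Nat.mod_eq_of_lt h1, Nat.mod_eq_of_lt h2] at e1 e2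
        exact ⟨by omega, e2⟩
      obtain ⟨e1, e2⟩ := dm _ _ _ _ _ (key x r.1).1 (key y r'.1).1 (by omega :
        (M * D) * (ℓ * a (T x) + b (T x)) + (D * I x + J x)
          = (M * D) * (ℓ * a (T y) + b (T y)) + (D * I y + J y))
      obtain ⟨e3, e4⟩ := dm _ _ _ _ _ (hb _ r.1) (hb _ r'.1) e1
      obtain ⟨e5, e6⟩ := dm _ _ _ _ _ (key x r.1).2 (key y r'.1).2 e2
      exact H.inj x y (hd _ r.1 _ r'.1 e3 e4) e5 e6
  · refine ⟨fun x hx => by simp [hx], fun x y h1 h2 h3 h4 => ?_, fun x y h1 h2 h3 h4 => ?_⟩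
    · right
      simp only [h1, ← h2, if_false, ← h3, h4]; ring
    · right
      simp only [h1, ← h2, if_false, ← h3, h4]; ring
  · intro x
    rcases H.range x with r | r
    · simp only [r.1, if_true]
      exact lt_of_lt_of_le r.2.1 (by omega)
    · have n2 : T x ≠ 0 := fun h => h0 (h ▸ r.1)
      simp only [n2, if_false]
      have k1 := (key x r.1).1
      have : ℓ * a (T x) + b (T x) + 1 ≤ (α + 1) * ℓ := by
        have := hb _ r.1
        have := Nat.mul_le_mul_left ℓ (ha _ r.1)
        nlinarith
      have := Nat.mul_le_mul_left (M * D) this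
      rw [mul_add] at this
      rw [mul_comm ((α + 1) * ℓ)]
      omega

theorem grid_arith1 {M k s S R : ℕ} (h : M * k ≤ s + S - R) (hs : s ≤ M) :
    M * (k - 1) ≤ S - R := by
  rw [Nat.mul_sub, mul_one]
  generalize M * k = K at *
  omega

theorem grid_arith2 {M k s S R : ℕ} (h : M * k ≤ (M - s) + ((M - s) + S) - R) :
    M * (k - 1) ≤ (M - 2 * s) + S - R := by
  rw [Nat.mul_sub, mul_one]
  generalize M * k = K at *
  omega

theorem grid_main {V : Type} [Fintype V] (ℓ α : ℕ) (hℓ : 1 ≤ ℓ) : ∀ (c : ℕ) (A : Finset ℕ)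
    (a b : ℕ → ℕ) (p : ℕ) (T I J : V → ℕ), A.card = c →
    GridInv A (fun t => 2 ^ a t) (fun t => 2 ^ b t) p T I J →
    (∀ t ∈ A, a t ≤ α) → (∀ t ∈ A, b t ≤ ℓ) →
    ∀ k : ℕ, 2 ^ α * k ≤ ∑ t ∈ A, (2 ^ α - 2 ^ (a t + b t)) - 2 ^ α * ((α + 1) * ℓ) →
    ∃ L : List (V → ℕ), 2 ^ k ≤ L.length ∧ L.Pairwise (SepPos (2 ^ ℓ)) ∧
      ∀ f ∈ L, Function.Injective f ∧ Resp (2 ^ ℓ) T I J f ∧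
        ∀ x, f x < Fintype.card V + (α + 1) * ℓ * (2 ^ α * 2 ^ ℓ) := by
  intro c
  induction c using Nat.strong_induction_on with
  | _ c ih =>
  intro A a b p T I J hc H ha hb k hk
  have h0 := H.zero_notMem
  have hMp : 0 < 2 ^ α := by positivity
  by_cases h1 : ∃ g ∈ A, b g = ℓ
  · -- absorb
    obtain ⟨g, hg, hbg⟩ := h1
    have hw : (fun t => 2 ^ b t) g = 2 ^ ℓ := by simp [hbg]
    have hD : 0 < 2 ^ ℓ := by positivity
    have S1 := H.absorb hD hg hw (fun j => j) (fun j h => h) (fun j h => rfl)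
    have S2 := H.absorb hD hg hw (fun j => 2 ^ ℓ - 1 - j) (fun j h => by omega)
      (fun j h => by omega)
    have hcard : (A.erase g).card < c := by rw [← hc]; exact Finset.card_erase_lt_of_mem hg
    have hk' : 2 ^ α * (k - 1) ≤ ∑ t ∈ A.erase g, (2 ^ α - 2 ^ (a t + b t))
        - 2 ^ α * ((α + 1) * ℓ) := by
      rw [← Finset.add_sum_erase A _ hg] at hk
      exact grid_arith1 hk (Nat.sub_le _ _)
    have ha' : ∀ t ∈ A.erase g, a t ≤ α := fun t ht => ha t (Finset.mem_of_mem_erase ht)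
    have hb' : ∀ t ∈ A.erase g, b t ≤ ℓ := fun t ht => hb t (Finset.mem_of_mem_erase ht)
    obtain ⟨L1, l1, q1, r1⟩ := ih _ hcard _ _ _ _ _ _ _ rfl S1 ha' hb' _ hk'
    obtain ⟨L2, l2, q2, r2⟩ := ih _ hcard _ _ _ _ _ _ _ rfl S2 ha' hb' _ hk'
    refine ⟨L1 ++ L2, ?_, ?_, ?_⟩
    · rw [List.length_append]
      rcases k with _ | k
      · simp at l1 l2 ⊢; omega
      · simp only [Nat.add_sub_cancel] at l1 l2; rw [pow_succ]; omega
    · rw [List.pairwise_append]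
      refine ⟨q1, q2, fun f hf f' hf' => ?_⟩
      exact H.sep_absorb hD hg hw (by positivity) (r1 f hf).2.1 (r2 f' hf').2.1
    · intro f hf
      rcases List.mem_append.1 hf with hf | hf
      · exact ⟨(r1 f hf).1, (r1 f hf).2.1.of_absorb H hg hw (fun j => j) (fun j hj => Or.inr rfl),
          (r1 f hf).2.2⟩
      · exact ⟨(r2 f hf).1, (r2 f hf).2.1.of_absorb H hg hw (fun j => 2 ^ ℓ - 1 - j)
          (fun j hj => Or.inl (by omega)), (r2 f hf).2.2⟩
  have hb2 : ∀ t ∈ A, b t < ℓ := fun t ht =>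
    lt_of_le_of_ne (hb t ht) (fun h => h1 ⟨t, ht, h⟩)
  by_cases h2 : ∃ g ∈ A, ∃ h ∈ A, a g = a h ∧ b g = b h ∧ g ≠ h
  · obtain ⟨g, hg, h, hh, ea, eb, hne⟩ := h2
    have hm : (fun t => 2 ^ a t) g = (fun t => 2 ^ a t) h := by simp [ea]
    have hw : (fun t => 2 ^ b t) g = (fun t => 2 ^ b t) h := by simp [eb]
    have hg0 : g ≠ 0 := fun h => h0 (h ▸ hg)
    have hh0 : h ≠ 0 := fun h => h0 (h ▸ hh)
    have S1 := H.vert hg hh hne hm hw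
    have S2 := H.horz hg hh hne hm hw
    have u1 : ∀ e : ℕ → ℕ, Function.update (fun t => 2 ^ e t) g (2 * (fun t => 2 ^ e t) g)
        = fun t => 2 ^ (Function.update e g (e g + 1) t) := by
      intro e; funext t
      by_cases ht : t = g
      · subst ht; simp [pow_succ, mul_comm]
      · simp [Function.update_of_ne ht]
    rw [u1] at S1 S2
    have hcard : (A.erase h).card < c := by rw [← hc]; exact Finset.card_erase_lt_of_mem hh
    have hgh : g ∈ A.erase h := Finset.mem_erase.2 ⟨hne, hg⟩
    have hbb : ∀ t ∈ A.erase h, Function.update b g (b g + 1) t ≤ ℓ := by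
      intro t ht
      have := hb t (Finset.mem_of_mem_erase ht)
      have := hb2 g hg
      rw [Function.update_apply]; split_ifs <;> omega
    have hb' : ∀ t ∈ A.erase h, b t ≤ ℓ := fun t ht => hb t (Finset.mem_of_mem_erase ht)
    have ha' : ∀ t ∈ A.erase h, a t ≤ α := fun t ht => ha t (Finset.mem_of_mem_erase ht)
    -- sums
    have hsum : ∑ t ∈ A, (2 ^ α - 2 ^ (a t + b t)) = (2 ^ α - 2 ^ (a g + b g)) +
        ((2 ^ α - 2 ^ (a g + b g)) + ∑ t ∈ (A.erase h).erase g, (2 ^ α - 2 ^ (a t + b t))) := by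
      rw [← Finset.add_sum_erase A _ hh, ← Finset.add_sum_erase (A.erase h) _ hgh, ea, eb]
    have hs1 : ∑ t ∈ A.erase h, (2 ^ α - 2 ^ (Function.update a g (a g + 1) t + b t)) =
        (2 ^ α - 2 * 2 ^ (a g + b g)) +
          ∑ t ∈ (A.erase h).erase g, (2 ^ α - 2 ^ (a t + b t)) := by
      rw [← Finset.add_sum_erase (A.erase h) _ hgh]
      congr 1
      · rw [Function.update_self, ← pow_succ']; congr 2; ring
      · apply Finset.sum_congr rfl
        intro t ht
        rw [Function.update_of_ne (Finset.ne_of_mem_erase ht)]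
    have hs2 : ∑ t ∈ A.erase h, (2 ^ α - 2 ^ (a t + Function.update b g (b g + 1) t)) =
        (2 ^ α - 2 * 2 ^ (a g + b g)) +
          ∑ t ∈ (A.erase h).erase g, (2 ^ α - 2 ^ (a t + b t)) := by
      rw [← Finset.add_sum_erase (A.erase h) _ hgh]
      congr 1
      · rw [Function.update_self, ← pow_succ']; congr 2
      · apply Finset.sum_congr rfl
        intro t ht
        rw [Function.update_of_ne (Finset.ne_of_mem_erase ht)]
    by_cases hbig : α ≤ a g + b g
    · -- forced
      have hle : 2 ^ α ≤ 2 ^ (a g + b g) := Nat.pow_le_pow_right (by norm_num) hbig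
      obtain ⟨L2, l2, q2, r2⟩ := ih _ hcard _ _ _ _ _ _ _ rfl S2 ha' hbb k
        (by rw [hs2]; rw [hsum, Nat.sub_eq_zero_of_le hle, zero_add, zero_add] at hk
            exact hk.trans (Nat.sub_le_sub_right (Nat.le_add_left _ _) _))
      refine ⟨L2, l2, q2, fun f hf => ⟨(r2 f hf).1, (r2 f hf).2.1.of_horz H hg hh hm hw,
        (r2 f hf).2.2⟩⟩
    · have ha1 : ∀ t ∈ A.erase h, Function.update a g (a g + 1) t ≤ α := by
        intro t ht
        have := ha t (Finset.mem_of_mem_erase ht)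
        rw [Function.update_apply]; split_ifs <;> omega
      have hk1 : 2 ^ α * (k - 1) ≤ (2 ^ α - 2 * 2 ^ (a g + b g)) +
          ∑ t ∈ (A.erase h).erase g, (2 ^ α - 2 ^ (a t + b t)) - 2 ^ α * ((α + 1) * ℓ) := by
        rw [hsum] at hk
        exact grid_arith2 hk
      obtain ⟨L1, l1, q1, r1⟩ := ih _ hcard _ _ _ _ _ _ _ rfl S1 ha1 hb' (k - 1) (hs1 ▸ hk1)
      obtain ⟨L2, l2, q2, r2⟩ := ih _ hcard _ _ _ _ _ _ _ rfl S2 ha' hbb (k - 1) (hs2 ▸ hk1)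
      refine ⟨L1 ++ L2, ?_, ?_, ?_⟩
      · rw [List.length_append]
        rcases k with _ | k
        · simp at l1 l2 ⊢; omega
        · simp only [Nat.add_sub_cancel] at l1 l2; rw [pow_succ]; omega
      · rw [List.pairwise_append]
        refine ⟨q1, q2, fun f hf f' hf' => ?_⟩
        exact H.sep_merge hg hh hne hm hw (by positivity) (by positivity)
          (r1 f hf).2.1 (r2 f' hf').2.1
      · intro f hf
        rcases List.mem_append.1 hf with hf | hf
        · exact ⟨(r1 f hf).1, (r1 f hf).2.1.of_vert hg0 hh0, (r1 f hf).2.2⟩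
        · exact ⟨(r2 f hf).1, (r2 f hf).2.1.of_horz H hg hh hm hw, (r2 f hf).2.2⟩
  · -- terminal
    obtain ⟨f, hf⟩ := grid_terminal ℓ α H ha hb2 (by
      intro g hg h hh e1 e2
      by_contra hne
      exact h2 ⟨g, hg, h, hh, e1, e2, hne⟩)
    have hk0 : k = 0 := by
      have hA : A.card ≤ (α + 1) * ℓ := by
        have := Finset.card_le_card_of_injOn (s := A)
          (t := Finset.range (α + 1) ×ˢ Finset.range ℓ) (fun t => (a t, b t))
          (fun t ht => by
            have := ha t ht
            have := hb2 t ht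
            simp; omega)
          (fun g hg h hh e => by
            by_contra hne
            simp only [Prod.mk.injEq] at e
            exact h2 ⟨g, hg, h, hh, e.1, e.2, hne⟩)
        simpa using this
      have hS : ∑ t ∈ A, (2 ^ α - 2 ^ (a t + b t)) ≤ 2 ^ α * ((α + 1) * ℓ) := by
        calc ∑ t ∈ A, (2 ^ α - 2 ^ (a t + b t)) ≤ ∑ t ∈ A, 2 ^ α :=
              Finset.sum_le_sum (fun t _ => Nat.sub_le _ _)
          _ = 2 ^ α * A.card := by simp [mul_comm]
          _ ≤ _ := Nat.mul_le_mul_left _ hA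
      rw [Nat.sub_eq_zero_of_le hS] at hk
      have := Nat.eq_zero_of_le_zero hk
      rcases Nat.mul_eq_zero.1 this with h | h
      · omega
      · exact h
    exact ⟨[f], by simp [hk0], by simp, by simpa using hf⟩

/-- many pairwise separated placements -/
theorem grid_family (ℓ α N : ℕ) (hℓ : 1 ≤ ℓ) (k : ℕ)
    (hk : 2 ^ α * k ≤ N * (2 ^ α - 1) - 2 ^ α * ((α + 1) * ℓ)) :
    ∃ L : List (Fin (N + 1) → ℕ), 2 ^ k ≤ L.length ∧ L.Pairwise (SepPos (2 ^ ℓ)) ∧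
      ∀ f ∈ L, Function.Injective f ∧
        ∀ x, f x < N + 1 + (α + 1) * ℓ * (2 ^ α * 2 ^ ℓ) := by
  have H : GridInv (Finset.Icc 1 N) (fun t => 2 ^ (fun _ => 0 : ℕ → ℕ) t)
      (fun t => 2 ^ (fun _ => 0 : ℕ → ℕ) t) 1
      (fun x : Fin (N + 1) => x.val) (fun _ => 0) (fun _ => 0) := by
    refine ⟨by simp, by norm_num, fun x y h _ _ => Fin.ext h, fun x => ?_, fun k hk => ?_, ?_⟩
    · have := x.2
      rcases Nat.eq_zero_or_pos x.val with h | h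
      · left; simp [h]
      · right; simp; omega
    · exact ⟨0, by simp, by omega⟩
    · intro t ht i j hi hj
      simp at ht hi hj
      exact ⟨⟨t, by omega⟩, by simp [hi, hj]⟩
  obtain ⟨L, h1, h2, h3⟩ := grid_main ℓ α hℓ _ _ _ _ _ _ _ _ rfl H (by simp) (by simp) k
    (by simpa using hk)
  exact ⟨L, h1, h2, fun f hf => ⟨(h3 f hf).1, fun x => by simpa using (h3 f hf).2.2 x⟩⟩

/-- walk along consecutive vertices -/
theorem exists_path_seq {V : Type} (G : SimpleGraph V) (v : ℕ → V) : ∀ d : ℕ,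
    (∀ i, i < d → G.Adj (v i) (v (i + 1))) →
    (∀ i j, i ≤ d → j ≤ d → v i = v j → i = j) →
    ∃ q : G.Walk (v d) (v 0), q.IsPath ∧ q.length = d ∧ ∀ x ∈ q.support, ∃ i ≤ d, x = v i := by
  intro d
  induction d with
  | zero => intro _ _; exact ⟨Walk.nil, by simp, rfl, by simp⟩
  | succ d ih =>
    intro h1 h2
    obtain ⟨q, a, b, c⟩ := ih (fun i hi => h1 i (by omega))
      (fun i j hi hj => h2 i j (by omega) (by omega))
    refine ⟨Walk.cons (h1 d (by omega)).symm q, ?_, by simp [b], ?_⟩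
    · rw [Walk.cons_isPath_iff]
      refine ⟨a, fun hm => ?_⟩
      obtain ⟨i, hi, e⟩ := c _ hm
      have := h2 _ _ le_rfl (by omega) e
      omega
    · intro x hx
      rw [Walk.support_cons, List.mem_cons] at hx
      rcases hx with rfl | hx
      · exact ⟨d + 1, le_rfl, rfl⟩
      · obtain ⟨i, hi, e⟩ := c _ hx
        exact ⟨i, by omega, e⟩

theorem ham_adj {n : ℕ} (σ : Fin n ≃ Fin n) (x y : Fin n) :
    ((pathGraph n).map σ.symm.toEmbedding).Adj x y ↔ DistEq 1 (σ x).val (σ y).val := by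
  rw [SimpleGraph.map_adj]
  constructor
  · rintro ⟨u, v, h, rfl, rfl⟩
    rw [pathGraph_adj] at h
    simp [DistEq]; omega
  · intro h
    refine ⟨σ x, σ y, ?_, by simp, by simp⟩
    rw [pathGraph_adj]
    unfold DistEq at h; omega

theorem ham_cycle_aux {n D : ℕ} (hD : 2 ≤ D) (σ τ : Fin n ≃ Fin n) (x y : Fin n)
    (h1 : DistEq 1 (σ x).val (σ y).val) (h2 : (τ y).val = (τ x).val + D) :
    ∃ (v : Fin n) (c : ((pathGraph n).map σ.symm.toEmbedding ⊔
      (pathGraph n).map τ.symm.toEmbedding).Walk v v), c.IsCycle ∧ c.length = D + 1 := by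
  set G := (pathGraph n).map σ.symm.toEmbedding
  set H := (pathGraph n).map τ.symm.toEmbedding with hH
  have hy := (τ y).2
  let v : ℕ → Fin n := fun i => if h : (τ x).val + i < n then τ.symm ⟨(τ x).val + i, h⟩ else x
  have hv : ∀ i ≤ D, (τ (v i)).val = (τ x).val + i := by
    intro i hi
    have : (τ x).val + i < n := by omega
    simp [v, this]
  have v0 : v 0 = x := τ.injective (Fin.ext (by simpa using hv 0 (by omega)))
  have vD : v D = y := τ.injective (Fin.ext (by rw [hv D le_rfl]; omega))
  obtain ⟨q, q1, q2, -⟩ := exists_path_seq H v D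
    (fun i hi => by
      rw [hH, ham_adj, hv i (by omega), hv (i + 1) (by omega)]; right; omega)
    (fun i j hi hj e => by
      have := congrArg (fun z => (τ z).val) e
      simp only [hv i hi, hv j hj] at this
      omega)
  have hxy : H.Adj x y → False := by
    rw [hH, ham_adj]; unfold DistEq; omega
  have hadj : (G ⊔ H).Adj (v 0) (v D) := by
    rw [v0, vD]; left; exact (ham_adj σ x y).2 h1
  refine ⟨v 0, Walk.cons hadj (q.mapLe le_sup_right), ?_, by simp [q2]⟩
  rw [Walk.cons_isCycle_iff]
  refine ⟨(Walk.isPath_mapLe _).2 q1, fun he => ?_⟩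
  rw [Walk.edges_mapLe_eq_edges] at he
  have := q.adj_of_mem_edges he
  rw [v0, vD] at this
  exact hxy this

/-- the cycle condition -/
def HamRel {n : ℕ} (ℓ : ℕ) (G H : SimpleGraph (Fin n)) : Prop :=
  ∃ (v : Fin n) (c : (G ⊔ H).Walk v v), c.IsCycle ∧ c.length = 2 ^ ℓ + 1

theorem HamRel.symm {n ℓ : ℕ} {G H : SimpleGraph (Fin n)} (h : HamRel ℓ G H) : HamRel ℓ H G := by
  unfold HamRel at *; rwa [sup_comm]

theorem ham_cycle {n ℓ : ℕ} (hℓ : 1 ≤ ℓ) (σ τ : Fin n ≃ Fin n) (x y : Fin n)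
    (h1 : DistEq 1 (σ x).val (σ y).val) (h2 : DistEq (2 ^ ℓ) (τ x).val (τ y).val) :
    HamRel ℓ ((pathGraph n).map σ.symm.toEmbedding) ((pathGraph n).map τ.symm.toEmbedding) := by
  have hD : 2 ≤ 2 ^ ℓ := by
    calc 2 = 2 ^ 1 := rfl
      _ ≤ 2 ^ ℓ := Nat.pow_le_pow_right (by norm_num) hℓ
  rcases h2 with h2 | h2
  · exact ham_cycle_aux hD σ τ y x h1.symm h2
  · exact ham_cycle_aux hD σ τ x y h1 h2

/-- colour of a Hamiltonian path -/
theorem ham_coloring {n : ℕ} {G : SimpleGraph (Fin n)} (h : IsHamPathGraph G) :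
    ∃ c : Fin n → Bool, ∀ x y, G.Adj x y → c x ≠ c y := by
  obtain ⟨σ, rfl⟩ := h
  refine ⟨fun x => decide (Even (σ.symm x).val), fun x y hxy => ?_⟩
  have := (ham_adj σ.symm x y).1 (by simpa using hxy)
  simp only [ne_eq, decide_eq_decide]
  rcases this with h | h <;> rw [h] <;> rw [Nat.even_add_one] <;> tauto

theorem no_rel_of_coloring {n ℓ : ℕ} (hℓ : 1 ≤ ℓ) {G H : SimpleGraph (Fin n)} (c : Fin n → Bool)
    (h1 : ∀ x y, G.Adj x y → c x ≠ c y) (h2 : ∀ x y, H.Adj x y → c x ≠ c y) :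
    ¬ HamRel ℓ G H := by
  rintro ⟨v, w, -, hw⟩
  let C : (G ⊔ H).Coloring Bool := Coloring.mk c (by
    intro x y h
    rcases h with h | h
    · exact h1 x y h
    · exact h2 x y h)
  have := (C.even_length_iff_congr w).2 Iff.rfl
  rw [hw] at this
  have h2 : Even (2 ^ ℓ) := (Nat.even_pow.2 ⟨even_two, by omega⟩)
  exact (Nat.not_even_iff_odd.2 h2.add_one) this

theorem ham_card_le {n ℓ : ℕ} (hℓ : 1 ≤ ℓ) (F : Finset (SimpleGraph (Fin n)))
    (hF : ∀ G ∈ F, IsHamPathGraph G)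
    (hP : (F : Set (SimpleGraph (Fin n))).Pairwise (HamRel ℓ)) : F.card ≤ 2 ^ n := by
  choose! c hc using fun G (hG : G ∈ F) => ham_coloring (hF G hG)
  have : F.card ≤ (Finset.univ : Finset (Fin n → Bool)).card := by
    apply Finset.card_le_card_of_injOn c (fun _ _ => Finset.mem_univ _)
    intro G hG H hH e
    by_contra hne
    refine no_rel_of_coloring hℓ (c G) (hc G hG) ?_ (hP hG hH hne)
    rw [e]; exact hc H hH
  simpa using this

theorem hamQ_bdd {ℓ : ℕ} (hℓ : 1 ≤ ℓ) (n : ℕ) : ∀ x ∈ {m : ℕ | ∃ F : Finset (SimpleGraph (Fin n)),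
    (∀ G ∈ F, IsHamPathGraph G) ∧
    (F : Set (SimpleGraph (Fin n))).Pairwise (fun G H =>
      ∃ (v : Fin n) (c : (G ⊔ H).Walk v v), c.IsCycle ∧ c.length = 2 ^ ℓ + 1) ∧
    F.card = m}, x ≤ 2 ^ n := by
  rintro _ ⟨F, h1, h2, rfl⟩
  exact ham_card_le hℓ F h1 h2

theorem hamQ_le {ℓ : ℕ} (hℓ : 1 ≤ ℓ) (n : ℕ) : hamQ ℓ n ≤ 2 ^ n :=
  csSup_le ⟨0, ∅, by simp⟩ (hamQ_bdd hℓ n)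

theorem le_hamQ {ℓ : ℕ} (hℓ : 1 ≤ ℓ) {n : ℕ} (L : List (SimpleGraph (Fin n)))
    (h1 : ∀ G ∈ L, IsHamPathGraph G) (h2 : L.Pairwise (HamRel ℓ)) : L.length ≤ hamQ ℓ n := by
  classical
  have hnd : L.Nodup := by
    refine List.Pairwise.imp_of_mem ?_ h2
    rintro G H hG hH h rfl
    obtain ⟨c, hc⟩ := ham_coloring (h1 G hG)
    exact no_rel_of_coloring hℓ c hc hc h
  rw [← List.toFinset_card_of_nodup hnd]
  refine le_csSup ⟨2 ^ n, hamQ_bdd hℓ n⟩ ⟨L.toFinset, by simpa using h1, ?_, rfl⟩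
  intro G hG H hH hne
  simp only [List.coe_toFinset, Set.mem_ofPred_eq] at hG hH
  have : Std.Symm (HamRel ℓ (n := n)) := ⟨fun _ _ h => HamRel.symm h⟩
  exact h2.forall hG hH hne

theorem extend_pos {N n : ℕ} (hN : N + 1 ≤ n) (f : Fin (N + 1) → ℕ) (hf : Function.Injective f)
    (hb : ∀ x, f x < n) :
    ∃ σ : Fin n ≃ Fin n, ∀ x : Fin (N + 1), (σ (Fin.castLE hN x)).val = f x := by
  classical
  have i1 : Function.Injective (Fin.castLE hN) := Fin.castLE_injective hN
  have i2 : Function.Injective (fun x => (⟨f x, hb x⟩ : Fin n)) := by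
    intro x y h
    exact hf (by simpa using h)
  let e : {x // x ∈ Set.range (Fin.castLE hN)} ≃
      {x // x ∈ Set.range (fun x => (⟨f x, hb x⟩ : Fin n))} :=
    (Equiv.ofInjective _ i1).symm.trans (Equiv.ofInjective _ i2)
  refine ⟨e.extendSubtype, fun x => ?_⟩
  rw [e.extendSubtype_apply_of_mem _ ⟨x, rfl⟩]
  have : (Equiv.ofInjective _ i1).symm ⟨Fin.castLE hN x, ⟨x, rfl⟩⟩ = x :=
    Equiv.ofInjective_symm_apply i1 x
  simp [e, this]

theorem hamQ_lower (ℓ α N n k : ℕ) (hℓ : 1 ≤ ℓ)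
    (hn : N + 1 + (α + 1) * ℓ * (2 ^ α * 2 ^ ℓ) ≤ n)
    (hk : 2 ^ α * k ≤ N * (2 ^ α - 1) - 2 ^ α * ((α + 1) * ℓ)) : 2 ^ k ≤ hamQ ℓ n := by
  obtain ⟨L, h1, h2, h3⟩ := grid_family ℓ α N hℓ k hk
  have hN : N + 1 ≤ n := by omega
  choose! s hs using fun f (hf : f ∈ L) =>
    extend_pos hN f (h3 f hf).1 (fun x => lt_of_lt_of_le ((h3 f hf).2 x) hn)
  have := le_hamQ hℓ (L.map (fun f => (pathGraph n).map (s f).symm.toEmbedding)) ?_ ?_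
  · rw [List.length_map] at this; omega
  · intro G hG
    obtain ⟨f, -, rfl⟩ := List.mem_map.1 hG
    exact ⟨(s f).symm, rfl⟩
  · rw [List.pairwise_map]
    refine List.Pairwise.imp_of_mem ?_ h2
    rintro f g hf hg ⟨x, y, h | h⟩
    · apply ham_cycle hℓ (s f) (s g) (Fin.castLE hN x) (Fin.castLE hN y)
      · rw [hs f hf, hs f hf]; exact h.1
      · rw [hs g hg, hs g hg]; exact h.2
    · apply HamRel.symm
      apply ham_cycle hℓ (s g) (s f) (Fin.castLE hN x) (Fin.castLE hN y)
      · rw [hs g hg, hs g hg]; exact h.1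
      · rw [hs f hf, hs f hf]; exact h.2

theorem hamQ_lower_real (ℓ α : ℕ) (hℓ : 1 ≤ ℓ) : ∃ C : ℝ, ∀ n : ℕ,
    (n : ℝ) * (1 - (1 / 2) ^ α) - C ≤ 0 ∨
    (2 : ℝ) ^ ((n : ℝ) * (1 - (1 / 2) ^ α) - C) ≤ hamQ ℓ n := by
  set c0 := 1 + (α + 1) * ℓ * (2 ^ α * 2 ^ ℓ) with hc0
  refine ⟨c0 + (α + 1) * ℓ + 1, fun n => ?_⟩
  set M := 2 ^ α with hM
  have hMp : 1 ≤ M := Nat.one_le_two_pow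
  have hMr : ((1 : ℝ) / 2) ^ α = 1 / (M : ℝ) := by rw [hM]; push_cast; rw [one_div_pow]
  have hM0 : (1 : ℝ) ≤ M := by exact_mod_cast hMp
  rw [hMr]
  have h1M : (1 : ℝ) / M ≤ 1 := by rw [div_le_one (by linarith)]; exact hM0
  have h1M0 : (0 : ℝ) ≤ 1 / M := by positivity
  by_cases hn : n < c0
  · left
    have : (n : ℝ) ≤ c0 := by exact_mod_cast hn.le
    have h2 : (n : ℝ) * (1 - 1 / M) ≤ n := by
      have : (0 : ℝ) ≤ n := by positivity
      nlinarith
    have h3 : (0 : ℝ) ≤ (α + 1) * ℓ := by positivity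
    linarith
  right
  set X := (n - c0) * (M - 1) - M * ((α + 1) * ℓ) with hX
  have hlow := hamQ_lower ℓ α (n - c0) n (X / M) hℓ (by omega) (Nat.mul_div_le _ _)
  have hlow' : (2 : ℝ) ^ (X / M) ≤ hamQ ℓ n := by exact_mod_cast hlow
  refine le_trans ?_ hlow'
  rw [← Real.rpow_natCast]
  apply Real.rpow_le_rpow_of_exponent_le (by norm_num)
  have a1 : (X : ℝ) / M ≤ ((X / M : ℕ) : ℝ) + 1 := by
    rw [div_le_iff₀ (by linarith)]
    have := Nat.lt_div_mul_add (a := X) (b := M) (by omega)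
    have : X ≤ (X / M + 1) * M := by rw [add_mul]; omega
    exact_mod_cast this
  have a2 : ((n : ℝ) - c0) * (M - 1) - M * ((α + 1) * ℓ) ≤ X := by
    have : (n - c0) * (M - 1) ≤ X + M * ((α + 1) * ℓ) := by omega
    have : (((n - c0 : ℕ) : ℝ)) * ((M - 1 : ℕ) : ℝ) ≤ X + M * ((α + 1) * ℓ) := by
      exact_mod_cast this
    rw [Nat.cast_sub (by omega), Nat.cast_sub hMp] at this
    push_cast at this
    linarith
  have a3 : (((n : ℝ) - c0) * (M - 1) - M * ((α + 1) * ℓ)) / M ≤ X / M := by gcongr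
  have a4 : (((n : ℝ) - c0) * (M - 1) - M * ((α + 1) * ℓ)) / M
      = ((n : ℝ) - c0) * (1 - 1 / M) - (α + 1) * ℓ := by field_simp
  have a5 : (c0 : ℝ) * (1 - 1 / M) ≤ c0 := by
    have : (0 : ℝ) ≤ c0 := by positivity
    nlinarith
  nlinarith

theorem hamQ_root_tendsto_two (ℓ : ℕ) (hℓ : 1 ≤ ℓ) :
    Filter.Tendsto (fun n : ℕ => (hamQ ℓ n : ℝ) ^ ((n : ℝ)⁻¹))
      Filter.atTop (nhds 2) := by
  rw [tendsto_order]
  constructor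
  · intro c hc
    have t1 : Filter.Tendsto (fun α : ℕ => (2 : ℝ) ^ (1 - (1 / 2 : ℝ) ^ α)) Filter.atTop
        (nhds 2) := by
      have := (tendsto_pow_atTop_nhds_zero_of_lt_one (r := (1 / 2 : ℝ)) (by norm_num)
        (by norm_num)).const_sub 1
      have := ((Real.continuous_const_rpow (by norm_num : (2 : ℝ) ≠ 0)).tendsto _).comp this
      simpa [Function.comp_def] using this
    obtain ⟨α, hα, hα1⟩ := ((t1.eventually_const_lt hc).and (Filter.eventually_ge_atTop 1)).exists
    obtain ⟨C, hC⟩ := hamQ_lower_real ℓ α hℓ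
    have hpos : (0 : ℝ) < 1 - (1 / 2) ^ α := by
      have : ((1 : ℝ) / 2) ^ α < 1 := pow_lt_one₀ (by norm_num) (by norm_num) (by omega)
      linarith
    have t2 : Filter.Tendsto (fun n : ℕ => (2 : ℝ) ^ ((1 - (1 / 2 : ℝ) ^ α) - C / n)) Filter.atTop
        (nhds ((2 : ℝ) ^ (1 - (1 / 2 : ℝ) ^ α))) := by
      have := (tendsto_const_div_atTop_nhds_zero_nat C).const_sub (1 - (1 / 2 : ℝ) ^ α)
      have := ((Real.continuous_const_rpow (by norm_num : (2 : ℝ) ≠ 0)).tendsto _).comp this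
      simpa [Function.comp_def] using this
    have t3 : Filter.Tendsto (fun n : ℕ => (n : ℝ) * (1 - (1 / 2) ^ α) - C) Filter.atTop
        Filter.atTop :=
      Filter.tendsto_atTop_add_const_right _ _
        (tendsto_natCast_atTop_atTop.atTop_mul_const hpos)
    filter_upwards [t2.eventually_const_lt hα, t3.eventually_gt_atTop 0,
      Filter.eventually_ge_atTop 1] with n h1 h2 h3
    have hn : (0 : ℝ) < n := by exact_mod_cast h3
    refine lt_of_lt_of_le h1 ?_
    have h4 := (hC n).resolve_left (not_le.2 h2)
    calc (2 : ℝ) ^ ((1 - (1 / 2 : ℝ) ^ α) - C / n)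
        = ((2 : ℝ) ^ ((n : ℝ) * (1 - (1 / 2) ^ α) - C)) ^ ((n : ℝ)⁻¹) := by
          rw [← Real.rpow_mul (by norm_num)]
          congr 1
          field_simp
      _ ≤ _ := Real.rpow_le_rpow (by positivity) h4 (by positivity)
  · intro c hc
    filter_upwards [Filter.eventually_ge_atTop 1] with n h3
    refine lt_of_le_of_lt ?_ hc
    have h : (hamQ ℓ n : ℝ) ≤ 2 ^ n := by exact_mod_cast hamQ_le hℓ n
    calc (hamQ ℓ n : ℝ) ^ ((n : ℝ)⁻¹) ≤ ((2 : ℝ) ^ n) ^ ((n : ℝ)⁻¹) :=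
          Real.rpow_le_rpow (by positivity) h (by positivity)
      _ = 2 := Real.pow_rpow_inv_natCast (by norm_num) (by omega)
end
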